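/- arXiv:2508.12717 — 2 statements merged into one kernel-verified Lean document; each statement's English description precedes it below -/
import Mathlib

section
/- For every integer n ≥ 1 there exists a bijection φ from S_{n−1} × {0, 1, …, n−1} onto S_n such that for every σ ∈ S_{n−1} and every integer c with 0 ≤ c ≤ n−1: (i) if 0 ≤ c ≤ exc(σ) then Exc(φ(σ,c)) = Exc(σ), while if c > exc(σ) then Exc(φ(σ,c)) = Exc(σ) ∪ {k_d}, where d = c − exc(σ) and k_d is the d-th smallest element of [n−1] \ Exc(σ); and (ii) den(φ(σ,c)) = den(σ) + c. (Theorem 2.1.) -/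
open Finset

namespace PaperStmt

/-- 1-based position of `i : Fin n` (so positions run through `1,…,n`). -/
def pos1 {n : ℕ} (i : Fin n) : ℕ := (i : ℕ) + 1

/-- 1-based value `σ_i` of the permutation `σ` at position `i`. -/
def val1 {n : ℕ} (σ : Equiv.Perm (Fin n)) (i : Fin n) : ℕ := (σ i : ℕ) + 1

/-- The number of inversions of the subsequence of `σ` consisting of the letters at the
positions satisfying `P`: pairs of positions `i < j`, both satisfying `P`,
with `σ_i > σ_j`. -/
def invOn {n : ℕ} (σ : Equiv.Perm (Fin n)) (P : Fin n → Prop) [DecidablePred P] : ℕ :=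
  (univ.filter fun p : Fin n × Fin n =>
    p.1 < p.2 ∧ P p.1 ∧ P p.2 ∧ val1 σ p.2 < val1 σ p.1).card

/-- `inv σ`: the number of inversions of `σ`. -/
def inv {n : ℕ} (σ : Equiv.Perm (Fin n)) : ℕ := invOn σ (fun _ => True)

/-- `Exc(σ)`: the set of excedances, i.e. positions `i` with `σ_i > i`. -/
def excSet {n : ℕ} (σ : Equiv.Perm (Fin n)) : Finset (Fin n) :=
  univ.filter fun i => pos1 i < val1 σ i

/-- `exc σ`: the number of excedances. -/
def exc {n : ℕ} (σ : Equiv.Perm (Fin n)) : ℕ := (excSet σ).card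

/-- `exc_r(σ)`: the number of `r`-level excedances, i.e. positions `i ≥ r` with `σ_i > i`. -/
def excLvl {n : ℕ} (r : ℕ) (σ : Equiv.Perm (Fin n)) : ℕ :=
  (univ.filter fun i => pos1 i < val1 σ i ∧ r ≤ pos1 i).card

/-- Denert's statistic `den σ`. -/
def den {n : ℕ} (σ : Equiv.Perm (Fin n)) : ℕ :=
  ((univ.filter fun i => pos1 i < val1 σ i).sum pos1)
  + invOn σ (fun i => pos1 i < val1 σ i)
  + invOn σ (fun i => ¬ pos1 i < val1 σ i)

/-- The `h`-level Denert statistic `den_h(σ)`. -/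
def denLvl {n : ℕ} (h : ℕ) (σ : Equiv.Perm (Fin n)) : ℕ :=
  ((univ.filter fun i => pos1 i < val1 σ i ∧ h ≤ val1 σ i).sum pos1)
  + invOn σ (fun i => pos1 i < val1 σ i ∧ h ≤ val1 σ i)
  + invOn σ (fun i => ¬ (pos1 i < val1 σ i ∧ h ≤ val1 σ i))

/-- `g exc_ℓ(σ)`: the number of `g`-gap `ℓ`-level excedances,
i.e. positions `i ≥ ℓ` with `σ_i ≥ i + g`. -/
def gexc {n : ℕ} (g l : ℕ) (σ : Equiv.Perm (Fin n)) : ℕ :=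
  (univ.filter fun i => pos1 i + g ≤ val1 σ i ∧ l ≤ pos1 i).card

/-- `gExclp_h(σ)`: the set of `g`-gap `h`-level excedance-letter positions,
i.e. positions `i` with `σ_i ≥ i + g` and `σ_i ≥ h`. -/
def gExclpSet {n : ℕ} (g h : ℕ) (σ : Equiv.Perm (Fin n)) : Finset (Fin n) :=
  univ.filter fun i => pos1 i + g ≤ val1 σ i ∧ h ≤ val1 σ i

/-- The `g`-gap `h`-level Denert statistic `g den_h(σ)`. -/
def gden {n : ℕ} (g h : ℕ) (σ : Equiv.Perm (Fin n)) : ℕ :=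
  ((univ.filter fun i => pos1 i + g ≤ val1 σ i ∧ h ≤ val1 σ i).sum fun i => pos1 i + g - 1)
  + invOn σ (fun i => pos1 i + g ≤ val1 σ i ∧ h ≤ val1 σ i)
  + invOn σ (fun i => ¬ (pos1 i + g ≤ val1 σ i ∧ h ≤ val1 σ i))

/-- `rexc σ`: the number of `r`-excedances, i.e. positions `i` with `σ_i ≥ i + r`. -/
def rexc {n : ℕ} (r : ℕ) (σ : Equiv.Perm (Fin n)) : ℕ :=
  (univ.filter fun i => pos1 i + r ≤ val1 σ i).card

/-- The `r`-Denert statistic `rden σ`. -/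
def rden {n : ℕ} (r : ℕ) (σ : Equiv.Perm (Fin n)) : ℕ :=
  ((univ.filter fun i => pos1 i + r ≤ val1 σ i).sum fun i => pos1 i + r - 1)
  + invOn σ (fun i => pos1 i + r ≤ val1 σ i)
  + invOn σ (fun i => ¬ pos1 i + r ≤ val1 σ i)

/-- Pairs `(i, i+1)` of adjacent positions forming an `r`-descent: `σ_i ≥ σ_{i+1} + r`. -/
def rdesPairs {n : ℕ} (r : ℕ) (σ : Equiv.Perm (Fin n)) : Finset (Fin n × Fin n) :=
  univ.filter fun p => pos1 p.2 = pos1 p.1 + 1 ∧ val1 σ p.2 + r ≤ val1 σ p.1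

/-- `rdes σ`: the number of `r`-descents. -/
def rdes {n : ℕ} (r : ℕ) (σ : Equiv.Perm (Fin n)) : ℕ := (rdesPairs r σ).card

/-- `rmaj σ`: the sum of the `r`-descents plus the number of pairs `i < j`
with `σ_j < σ_i < σ_j + r`. -/
def rmaj {n : ℕ} (r : ℕ) (σ : Equiv.Perm (Fin n)) : ℕ :=
  ((rdesPairs r σ).sum fun p => pos1 p.1)
  + (univ.filter fun p : Fin n × Fin n =>
      p.1 < p.2 ∧ val1 σ p.2 < val1 σ p.1 ∧ val1 σ p.1 < val1 σ p.2 + r).card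

/-- `des σ`: the number of descents, i.e. positions `i ∈ [n-1]` with `σ_i > σ_{i+1}`. -/
def des {n : ℕ} (σ : Equiv.Perm (Fin n)) : ℕ :=
  (univ.filter fun p : Fin n × Fin n =>
    pos1 p.2 = pos1 p.1 + 1 ∧ val1 σ p.2 < val1 σ p.1).card

/-- `maj σ`: the major index, i.e. the sum of the descents of `σ`. -/
def maj {n : ℕ} (σ : Equiv.Perm (Fin n)) : ℕ :=
  ((univ.filter fun p : Fin n × Fin n =>
    pos1 p.2 = pos1 p.1 + 1 ∧ val1 σ p.2 < val1 σ p.1).sum fun p => pos1 p.1)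

/-- The `q`-integer `1 + q + ⋯ + q ^ (k - 1)`. -/
def qNat {R : Type*} [CommRing R] (q : R) (k : ℕ) : R := ∑ i ∈ range k, q ^ i

theorem qNat_zero {R : Type*} [CommRing R] (q : R) : qNat q 0 = 0 := by simp [qNat]

theorem qNat_succ {R : Type*} [CommRing R] (q : R) (k : ℕ) :
    qNat q (k + 1) = 1 + q * qNat q k := by
  simp [qNat, sum_range_succ', mul_sum, pow_succ', add_comm]

/-- The number of elements of `E` smaller than `t`. -/
def cntLT (E : Finset ℕ) (t : ℕ) : ℕ := (E.filter (· < t)).card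

/-- The total weight of the `j`-element sets `V ⊆ {0, …, t - 1}` of excedance letters, for the
set of excedance positions `E`. -/
def letterSum {R : Type*} [CommRing R] (q : R) (E : Finset ℕ) (t j : ℕ) : R :=
  ∑ V ∈ powersetCard j (range t),
    ∏ s ∈ range t, qNat q (cntLT E s + 1 - cntLT V (s + 1))

theorem letterSum_zero_succ {R : Type*} [CommRing R] (q : R) (E : Finset ℕ) (j : ℕ) :
    letterSum q E 0 (j + 1) = 0 := by
  simp [letterSum]

theorem cntLT_eq_card {V : Finset ℕ} {t : ℕ} (hV : V ⊆ range t) : cntLT V t = V.card := by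
  rw [cntLT, filter_true_of_mem]
  intro x hx
  simpa using hV hx

theorem cntLT_insert_self (V : Finset ℕ) {s t : ℕ} (h : s < t) :
    cntLT (insert t V) (s + 1) = cntLT V (s + 1) := by
  rw [cntLT, cntLT, filter_insert, if_neg (by omega)]

theorem letterSum_succ_zero {R : Type*} [CommRing R] (q : R) (E : Finset ℕ) (t : ℕ) :
    letterSum q E (t + 1) 0 = qNat q (cntLT E t + 1) * letterSum q E t 0 := by
  simp [letterSum, prod_range_succ, cntLT, mul_comm]

theorem letterSum_succ_succ {R : Type*} [CommRing R] (q : R) (E : Finset ℕ) (t j : ℕ) :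
    letterSum q E (t + 1) (j + 1) =
      qNat q (cntLT E t - j) * (letterSum q E t (j + 1) + letterSum q E t j) := by
  have ht : t ∉ range t := by simp
  have key : ∀ i : ℕ, ∀ V ∈ powersetCard i (range t), ∀ V' : Finset ℕ,
      V'.card = j + 1 → (V' = V ∨ V' = insert t V) →
      ∏ s ∈ range (t + 1), qNat q (cntLT E s + 1 - cntLT V' (s + 1)) =
      qNat q (cntLT E t - j) * ∏ s ∈ range t, qNat q (cntLT E s + 1 - cntLT V (s + 1)) := by
    intro i V hV V' hcard hV'
    rw [mem_powersetCard] at hV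
    have hsub : V' ⊆ range (t + 1) := by
      intro x hx
      rcases hV' with rfl | rfl
      · have := hV.1 hx
        simp at this ⊢
        omega
      · rcases mem_insert.1 hx with rfl | hx
        · simp
        · have := hV.1 hx
          simp at this ⊢
          omega
    rw [prod_range_succ, mul_comm, cntLT_eq_card hsub, hcard, Nat.add_sub_add_right]
    congr 1
    refine prod_congr rfl fun s hs => ?_
    rcases hV' with rfl | rfl
    · rfl
    · rw [cntLT_insert_self V (by simpa using hs)]
  rw [letterSum, range_add_one, powersetCard_succ_insert ht, sum_union, sum_image, mul_add,
    letterSum, letterSum, mul_sum, mul_sum, ← range_add_one]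
  · congr 1
    · refine sum_congr rfl fun V hV => ?_
      exact key _ V hV V (mem_powersetCard.1 hV).2 (Or.inl rfl)
    · refine sum_congr rfl fun V hV => ?_
      have hV2 := mem_powersetCard.1 hV
      refine key _ V hV _ ?_ (Or.inr rfl)
      rw [card_insert_of_notMem (fun h => ht (hV2.1 h)), hV2.2]
  · intro A hA B hB hAB
    have hA' : t ∉ A := fun h => ht ((mem_powersetCard.1 hA).1 h)
    have hB' : t ∉ B := fun h => ht ((mem_powersetCard.1 hB).1 h)
    rw [← erase_insert hA', ← erase_insert hB']
    exact congrArg (fun s => erase s t) hAB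
  · rw [disjoint_left]
    intro A hA hB
    obtain ⟨B, -, rfl⟩ := mem_image.1 hB
    exact ht ((mem_powersetCard.1 hA).1 (mem_insert_self _ _))

theorem letterSum_eq_zero {R : Type*} [CommRing R] (q : R) (E : Finset ℕ) (t j : ℕ)
    (h : cntLT E t ≤ j) : letterSum q E (t + 1) (j + 1) = 0 := by
  rw [letterSum_succ_succ, Nat.sub_eq_zero_of_le h, qNat_zero, zero_mul]

theorem letterSum_congr {R : Type*} [CommRing R] (q : R) {E F : Finset ℕ} {t : ℕ}
    (h : ∀ s < t, cntLT E s = cntLT F s) (j : ℕ) : letterSum q E t j = letterSum q F t j := by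
  refine sum_congr rfl fun V _ => prod_congr rfl fun s hs => ?_
  rw [h s (by simpa using hs)]

theorem cntLT_erase_of_le (E : Finset ℕ) {e t : ℕ} (h : t ≤ e) :
    cntLT (E.erase e) t = cntLT E t := by
  unfold cntLT
  congr 1
  ext x
  simp only [mem_filter, mem_erase]
  grind

theorem cntLT_erase_of_lt {E : Finset ℕ} {e t : ℕ} (he : e ∈ E) (h : e < t) :
    cntLT (E.erase e) t = cntLT E t - 1 := by
  unfold cntLT
  rw [filter_erase, card_erase_of_mem (by simp [he, h])]

theorem cntLT_succ_of_mem {E : Finset ℕ} {t : ℕ} (h : t ∈ E) :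
    cntLT E (t + 1) = cntLT E t + 1 := by
  have : E.filter (· < t + 1) = insert t (E.filter (· < t)) := by
    ext x
    simp only [mem_filter, mem_insert]
    grind
  rw [cntLT, this, card_insert_of_notMem (by simp), cntLT]

theorem cntLT_succ_of_notMem {E : Finset ℕ} {t : ℕ} (h : t ∉ E) :
    cntLT E (t + 1) = cntLT E t := by
  unfold cntLT
  congr 1
  ext x
  simp only [mem_filter]
  grind

/-- The contribution to `letterSum` of the configurations in which one excedance position
has been added. -/
def eraseSum {R : Type*} [CommRing R] (q : R) (E : Finset ℕ) (t : ℕ) (f : ℕ → R) : R :=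
  ∑ e ∈ E with e < t, q ^ ((E.filter fun x => e < x ∧ x < t).card) * f e

theorem eraseSum_succ_of_notMem {R : Type*} [CommRing R] (q : R) {E : Finset ℕ} {t : ℕ}
    (f : ℕ → R) (h : t ∉ E) : eraseSum q E (t + 1) f = eraseSum q E t f := by
  have h1 : ∀ x ∈ E, (x < t + 1 ↔ x < t) := by grind
  unfold eraseSum
  rw [filter_congr h1]
  refine sum_congr rfl fun e _ => ?_
  congr 3
  exact filter_congr fun x hx => by rw [h1 x hx]

theorem eraseSum_succ_of_mem {R : Type*} [CommRing R] (q : R) {E : Finset ℕ} {t : ℕ}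
    (f : ℕ → R) (h : t ∈ E) : eraseSum q E (t + 1) f = f t + q * eraseSum q E t f := by
  have h1 : E.filter (· < t + 1) = insert t (E.filter (· < t)) := by
    ext x
    simp only [mem_filter, mem_insert]
    grind
  unfold eraseSum
  rw [h1, sum_insert (by simp), mul_sum]
  congr 1
  · have : (E.filter fun x => t < x ∧ x < t + 1) = ∅ := by
      apply filter_false_of_mem
      intro x _
      omega
    rw [this, card_empty, pow_zero, one_mul]
  · refine sum_congr rfl fun e he => ?_
    have he' : e < t := (mem_filter.1 he).2
    have : (E.filter fun x => e < x ∧ x < t + 1) =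
        insert t (E.filter fun x => e < x ∧ x < t) := by
      ext x
      simp only [mem_filter, mem_insert]
      grind
    rw [this, card_insert_of_notMem (by simp), pow_succ']
    ring

theorem eraseSum_letterSum_succ_zero {R : Type*} [CommRing R] (q : R) (E : Finset ℕ) (t : ℕ) :
    eraseSum q E t (fun e => letterSum q (E.erase e) (t + 1) 0) =
      qNat q (cntLT E t) * eraseSum q E t (fun e => letterSum q (E.erase e) t 0) := by
  unfold eraseSum
  rw [mul_sum]
  refine sum_congr rfl fun e he => ?_
  obtain ⟨he, het⟩ := mem_filter.1 he
  have hpos : 0 < cntLT E t := card_pos.2 ⟨e, by simp [he, het]⟩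
  dsimp only
  rw [letterSum_succ_zero, cntLT_erase_of_lt he het, Nat.sub_add_cancel hpos]
  ring

theorem eraseSum_letterSum_succ_succ {R : Type*} [CommRing R] (q : R) (E : Finset ℕ)
    (t j : ℕ) :
    eraseSum q E t (fun e => letterSum q (E.erase e) (t + 1) (j + 1)) =
      qNat q (cntLT E t - (j + 1)) *
        (eraseSum q E t (fun e => letterSum q (E.erase e) t (j + 1)) +
          eraseSum q E t (fun e => letterSum q (E.erase e) t j)) := by
  unfold eraseSum
  rw [← sum_add_distrib, mul_sum]
  refine sum_congr rfl fun e he => ?_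
  obtain ⟨he, het⟩ := mem_filter.1 he
  dsimp only
  rw [letterSum_succ_succ, cntLT_erase_of_lt he het, Nat.sub_sub, add_comm 1 j]
  ring

theorem letterSum_succ_eq {R : Type*} [CommRing R] (q : R) (E : Finset ℕ) (t j : ℕ) :
    letterSum q E (t + 1) (j + 1) =
      qNat q (cntLT E t + 1) * letterSum q E t (j + 1) +
        eraseSum q E t (fun e => letterSum q (E.erase e) t j) := by
  induction t generalizing j with
  | zero =>
    have h0 : cntLT E 0 = 0 := by simp [cntLT]
    rw [letterSum_eq_zero q E 0 j (by simp [h0]), letterSum_zero_succ]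
    simp [eraseSum]
  | succ t ih =>
    have hstep : eraseSum q E t (fun e => letterSum q (E.erase e) (t + 1) j) =
        qNat q (cntLT E t - j) *
          (letterSum q E (t + 1) (j + 1) + letterSum q E (t + 1) j) -
        qNat q (cntLT E t + 1) * letterSum q E (t + 1) (j + 1) := by
      cases j with
      | zero =>
        rw [eraseSum_letterSum_succ_zero, letterSum_succ_zero]
        have h2 := letterSum_succ_succ q E t 0
        rw [Nat.sub_zero] at h2 ⊢
        linear_combination (- qNat q (cntLT E t)) * ih 0 + qNat q (cntLT E t + 1) * h2
      | succ i =>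
        rw [eraseSum_letterSum_succ_succ]
        have h2 := letterSum_succ_succ q E t (i + 1)
        linear_combination (- qNat q (cntLT E t - (i + 1))) * (ih i + ih (i + 1)) +
          qNat q (cntLT E t + 1) * h2
    rw [letterSum_succ_succ]
    by_cases ht : t ∈ E
    · rw [eraseSum_succ_of_mem q _ ht, hstep, cntLT_succ_of_mem ht,
        letterSum_congr q (F := E) (fun s hs => cntLT_erase_of_le E (by omega)) j,
        qNat_succ q (cntLT E t + 1)]
      rcases le_or_gt j (cntLT E t) with hj | hj
      · rw [Nat.succ_sub hj, Nat.succ_eq_add_one, qNat_succ]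
        ring
      · obtain ⟨i, rfl⟩ : ∃ i, j = i + 1 := ⟨j - 1, by omega⟩
        rw [letterSum_eq_zero q E t i (by omega), letterSum_eq_zero q E t (i + 1) (by omega)]
        ring
    · rw [eraseSum_succ_of_notMem q _ ht, hstep, cntLT_succ_of_notMem ht]
      ring

theorem sum_comp_card_lt {R α : Type*} [AddCommMonoid R] [LinearOrder α] (S : Finset α)
    (G : ℕ → R) :
    ∑ v ∈ S, G (S.filter fun b => b < v).card = ∑ i ∈ range S.card, G i := by
  induction S using Finset.induction_on_max with
  | empty => simp
  | insert a S ha ih =>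
    have haS : a ∉ S := fun h => lt_irrefl _ (ha a h)
    rw [sum_insert haS, card_insert_of_notMem haS, sum_range_succ, ← ih, add_comm]
    congr 1
    · refine sum_congr rfl fun v hv => ?_
      rw [filter_insert, if_neg (ha v hv).not_gt]
    · rw [filter_insert, if_neg (lt_irrefl _), filter_true_of_mem ha]

theorem sum_pow_card_gt {R β : Type*} [CommRing R] [LinearOrder β] (q : R) (S : Finset β) :
    ∑ v ∈ S, q ^ (S.filter fun b => v < b).card = qNat q S.card :=
  sum_comp_card_lt (α := βᵒᵈ) S (q ^ ·)

/-- The bijection `α ≃ β` sending `a` to `b` and given by `e` elsewhere. -/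
def extendEquiv {α β : Type*} [DecidableEq α] [DecidableEq β] (a : α) (b : β)
    (e : {x // x ≠ a} ≃ {y // y ≠ b}) : α ≃ β :=
  (Equiv.optionSubtypeNe a).symm.trans ((Equiv.optionCongr e).trans (Equiv.optionSubtypeNe b))

theorem extendEquiv_self {α β : Type*} [DecidableEq α] [DecidableEq β] (a : α) (b : β)
    (e : {x // x ≠ a} ≃ {y // y ≠ b}) : extendEquiv a b e a = b := by
  simp [extendEquiv]

theorem extendEquiv_coe {α β : Type*} [DecidableEq α] [DecidableEq β] (a : α) (b : β)
    (e : {x // x ≠ a} ≃ {y // y ≠ b}) (x : {x // x ≠ a}) :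
    extendEquiv a b e x = e x := by
  simp [extendEquiv, Equiv.optionSubtypeNe_symm_of_ne x.2]

theorem extendEquiv_bijective {α β : Type*} [DecidableEq α] [DecidableEq β] (a : α) :
    Function.Bijective
      (fun p : Σ b : β, {x // x ≠ a} ≃ {y // y ≠ b} => extendEquiv a p.1 p.2) := by
  constructor
  · rintro ⟨b, e⟩ ⟨b', e'⟩ h
    have hb : b = b' := by
      have := congrArg (fun f : α ≃ β => f a) h
      simpa only [extendEquiv_self] using this
    subst hb
    congr 1
    ext x
    have := congrArg (fun f : α ≃ β => f x) h
    simpa only [extendEquiv_coe] using this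
  · intro e
    refine ⟨⟨e a, e.subtypeEquiv fun x => (e.injective.ne_iff).symm⟩, ?_⟩
    ext x
    by_cases hx : x = a
    · subst hx
      exact extendEquiv_self _ _ _
    · exact extendEquiv_coe a (e a) _ ⟨x, hx⟩

/-- The number of inversions of a bijection between finite linear orders. -/
def equivInv {α β : Type*} [Fintype α] [LinearOrder α] [LinearOrder β] (e : α ≃ β) : ℕ :=
  ∑ j, ∑ i, if i < j ∧ e j < e i then 1 else 0

theorem equivInv_extendEquiv {α β : Type*} [Fintype α] [LinearOrder α] [Fintype β]
    [LinearOrder β] (a : α) (ha : ∀ x, x ≤ a) (b : β) (e : {x // x ≠ a} ≃ {y // y ≠ b}) :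
    equivInv (extendEquiv a b e) = (univ.filter fun y => b < y).card + equivInv e := by
  unfold equivInv
  rw [Fintype.sum_eq_add_sum_subtype_ne _ a]
  congr 1
  · rw [card_filter, ← Equiv.sum_comp (extendEquiv a b e)]
    refine sum_congr rfl fun i _ => ?_
    rw [extendEquiv_self]
    refine if_congr ⟨fun h => h.2, fun h => ⟨lt_of_le_of_ne (ha i) ?_, h⟩⟩ rfl rfl
    rintro rfl
    rw [extendEquiv_self] at h
    exact lt_irrefl _ h
  · refine sum_congr rfl fun j _ => ?_
    rw [Fintype.sum_eq_add_sum_subtype_ne _ a, if_neg (fun h => (ha j).not_gt h.1), zero_add]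
    simp only [extendEquiv_coe, Subtype.coe_lt_coe]

theorem sum_pow_equivInv_aux {R : Type*} [CommRing R] (q : R) (k : ℕ) :
    ∀ {α β : Type} [Fintype α] [LinearOrder α] [Fintype β] [LinearOrder β] [Fintype (α ≃ β)]
      (r : α → β → Prop) [∀ a b, Decidable (r a b)]
      (_ : ∀ a a' b b', a' ≤ a → b ≤ b' → r a b → r a' b')
      (_ : Fintype.card α = k) (_ : Fintype.card β = k),
      ∑ e : α ≃ β, (if ∀ a, r a (e a) then q ^ equivInv e else 0) =
        ∏ a, qNat q ((univ.filter fun b => r a b).card - (univ.filter fun x => a < x).card) := by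
  induction k with
  | zero =>
    intro α β _ _ _ _ _ r _ _ hα hβ
    have := Fintype.card_eq_zero_iff.1 hα
    have := Fintype.card_eq_zero_iff.1 hβ
    let _ : Unique (α ≃ β) := ⟨⟨Equiv.equivOfIsEmpty α β⟩, fun e => by ext x; exact isEmptyElim x⟩
    rw [Fintype.sum_unique]
    simp [equivInv]
  | succ k ih =>
    intro α β _ _ _ _ _ r _ hr hα hβ
    have : Nonempty α := Fintype.card_pos_iff.1 (by omega)
    obtain ⟨a, ha⟩ : ∃ a : α, ∀ x, x ≤ a :=
      ⟨univ.max' univ_nonempty, fun x => le_max' _ _ (mem_univ x)⟩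
    rw [← (extendEquiv_bijective (β := β) a).sum_comp, Fintype.sum_sigma,
      Fintype.prod_eq_mul_prod_subtype_ne _ a]
    have h0 : (univ.filter fun x => a < x) = ∅ :=
      filter_false_of_mem fun x _ => (ha x).not_gt
    rw [h0, card_empty, Nat.sub_zero, ← sum_pow_card_gt, sum_mul, sum_filter]
    refine sum_congr rfl fun b _ => ?_
    have hall : ∀ e : {x // x ≠ a} ≃ {y // y ≠ b},
        (∀ x, r x (extendEquiv a b e x)) ↔ r a b ∧ ∀ x : {x // x ≠ a}, r x (e x) := by
      intro e
      constructor
      · intro h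
        refine ⟨by simpa only [extendEquiv_self] using h a, fun x => ?_⟩
        simpa only [extendEquiv_coe] using h x
      · rintro ⟨h1, h2⟩ x
        by_cases hx : x = a
        · subst hx
          rwa [extendEquiv_self]
        · have := extendEquiv_coe a b e ⟨x, hx⟩
          simp only at this
          rw [this]
          exact h2 ⟨x, hx⟩
    by_cases hab : r a b
    · rw [if_pos hab]
      have hgt : ((univ.filter fun y => r a y).filter fun y => b < y) =
          univ.filter fun y => b < y := by
        ext y
        simp only [mem_filter, mem_univ, true_and, and_iff_right_iff_imp]
        exact fun h => hr a a b y le_rfl h.le hab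
      have hprod : ∀ x : {x // x ≠ a},
          (univ.filter fun y => r x y).card - (univ.filter fun y => (x : α) < y).card =
          (univ.filter fun y : {y // y ≠ b} => r x y).card -
            (univ.filter fun y : {y // y ≠ a} => x < y).card := by
        intro x
        rw [card_filter, card_filter, card_filter, card_filter,
          Fintype.sum_eq_add_sum_subtype_ne _ b,
          Fintype.sum_eq_add_sum_subtype_ne (fun y => if (x : α) < y then 1 else 0) a,
          if_pos (hr a x b b (ha x) le_rfl hab), if_pos (lt_of_le_of_ne (ha x) x.2),
          Nat.add_sub_add_left]
        simp only [Subtype.coe_lt_coe]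
      have hcard : ∀ {γ : Type} [Fintype γ] [DecidableEq γ] (c : γ),
          Fintype.card γ = k + 1 → Fintype.card {y // y ≠ c} = k := by
        intro γ _ _ c h
        rw [Fintype.card_subtype_compl (fun y => y = c), Fintype.card_subtype_eq, h,
          Nat.add_sub_cancel]
      rw [hgt, prod_congr rfl fun x _ => by rw [hprod x],
        ← ih (fun (x : {x // x ≠ a}) (y : {y // y ≠ b}) => r x y)
          (fun x x' y y' => hr x x' y y') (hcard a hα) (hcard b hβ), mul_sum]
      refine sum_congr rfl fun e _ => ?_
      simp only [hall, hab, true_and, mul_ite, mul_zero, equivInv_extendEquiv a ha b e, pow_add]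
    · rw [if_neg hab]
      refine sum_eq_zero fun e _ => if_neg fun h => hab ((hall e).1 h).1

theorem sum_pow_equivInv {R : Type*} [CommRing R] (q : R) {α β : Type} [Fintype α]
    [LinearOrder α] [Fintype β] [LinearOrder β] [Fintype (α ≃ β)]
    (r : α → β → Prop) [∀ a b, Decidable (r a b)]
    (hr : ∀ a a' b b', a' ≤ a → b ≤ b' → r a b → r a' b')
    (h : Fintype.card α = Fintype.card β) :
    ∑ e : α ≃ β, (if ∀ a, r a (e a) then q ^ equivInv e else 0) =
      ∏ a, qNat q ((univ.filter fun b => r a b).card - (univ.filter fun x => a < x).card) :=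
  sum_pow_equivInv_aux q _ r hr h rfl

theorem sum_pow_equivInv_dual {R : Type*} [CommRing R] (q : R) {α β : Type} [Fintype α]
    [LinearOrder α] [Fintype β] [LinearOrder β] [i : Fintype (α ≃ β)]
    (r : α → β → Prop) [∀ a b, Decidable (r a b)]
    (hr : ∀ a a' b b', a ≤ a' → b' ≤ b → r a b → r a' b')
    (h : Fintype.card α = Fintype.card β) :
    ∑ e : α ≃ β, (if ∀ a, r a (e a) then q ^ equivInv e else 0) =
      ∏ a, qNat q ((univ.filter fun b => r a b).card - (univ.filter fun x => x < a).card) := by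
  let _ : Fintype (αᵒᵈ ≃ βᵒᵈ) := i
  have key := sum_pow_equivInv q (α := αᵒᵈ) (β := βᵒᵈ)
    (fun a b => r (OrderDual.ofDual a) (OrderDual.ofDual b))
    (fun a a' b b' h1 h2 => hr _ _ _ _ h1 h2) h
  refine Eq.trans ?_ key
  refine sum_congr rfl fun e _ => ?_
  refine if_congr Iff.rfl (congrArg _ ?_) rfl
  unfold equivInv
  rw [sum_comm]
  refine sum_congr rfl fun i _ => sum_congr rfl fun j _ => ?_
  exact if_congr Iff.rfl rfl rfl

theorem card_filter_subtype {α : Type*} [Fintype α] (p Q : α → Prop) [DecidablePred p]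
    [DecidablePred Q] :
    (univ.filter fun b : {x // p x} => Q b).card = (univ.filter fun x => p x ∧ Q x).card := by
  rw [← card_map (Function.Embedding.subtype p)]
  congr 1
  ext x
  simp only [mem_map, mem_filter, mem_univ, true_and, Function.Embedding.subtype_apply,
    Subtype.exists, exists_and_left, exists_prop, exists_eq_right_right]
  grind

theorem cntLT_map {n : ℕ} (E : Finset (Fin n)) (t : ℕ) :
    cntLT (E.map Fin.valEmbedding) t = (univ.filter fun x => x ∈ E ∧ (x : ℕ) < t).card := by
  rw [cntLT, filter_map, card_map]
  congr 1
  ext x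
  simp

theorem card_mem_add_card_notMem {n : ℕ} (E : Finset (Fin n)) {t : ℕ} (ht : t ≤ n) :
    (univ.filter fun x => x ∈ E ∧ (x : ℕ) < t).card +
      (univ.filter fun x => x ∉ E ∧ (x : ℕ) < t).card = t := by
  have h := card_filter_add_card_filter_not (s := univ.filter fun x : Fin n => (x : ℕ) < t)
    (fun x => x ∈ E)
  rw [filter_filter, filter_filter] at h
  simp only [and_comm (a := (_ : ℕ) < t)] at h
  rw [h, Fin.card_filter_val_lt, min_eq_right ht]

theorem card_gt_add_cntLT {n : ℕ} (E : Finset (Fin n)) (a : Fin n) :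
    (univ.filter fun x => x ∈ E ∧ a < x).card + cntLT (E.map Fin.valEmbedding) (a + 1) =
      E.card := by
  rw [cntLT_map, add_comm]
  have h := card_filter_add_card_filter_not (s := E) (fun x => (x : ℕ) < a + 1)
  rw [← h]
  congr 2
  · ext x
    simp
  · ext x
    simp only [mem_filter, mem_univ, true_and, Fin.lt_def]
    exact and_congr_right fun _ => by omega

theorem invOn_eq_sum {n : ℕ} (σ : Equiv.Perm (Fin n)) (P : Fin n → Prop) [DecidablePred P] :
    invOn σ P = ∑ j, ∑ i, if P j ∧ P i ∧ i < j ∧ σ j < σ i then 1 else 0 := by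
  rw [invOn, card_filter, Fintype.sum_prod_type_right]
  refine sum_congr rfl fun j _ => sum_congr rfl fun i _ => if_congr ?_ rfl rfl
  simp only [val1, Fin.lt_def]
  constructor
  · rintro ⟨h1, h2, h3, h4⟩
    exact ⟨h3, h2, h1, by omega⟩
  · rintro ⟨h1, h2, h3, h4⟩
    exact ⟨h3, h2, h1, by omega⟩

theorem invOn_eq_equivInv {n : ℕ} (σ : Equiv.Perm (Fin n)) (P p p' : Fin n → Prop)
    [DecidablePred P] [DecidablePred p] (hP : ∀ i, P i ↔ p i) (e : {x // p x} ≃ {x // p' x})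
    (he : ∀ x : {x // p x}, σ x = e x) :
    invOn σ P = equivInv e := by
  have hp : ∀ x, x ∈ univ.filter p ↔ p x := by simp
  rw [invOn_eq_sum, equivInv]
  simp only [hP, ite_and, ← Subtype.coe_lt_coe, ← he]
  rw [← sum_subtype (univ.filter p) hp
    (fun j : Fin n => ∑ i : {x // p x}, if (i : Fin n) < j then
      if σ j < σ i then 1 else 0 else 0), sum_filter]
  refine sum_congr rfl fun j _ => ?_
  rw [← sum_subtype (univ.filter p) hp
    (fun i : Fin n => if i < j then if σ j < σ i then 1 else 0 else 0), sum_filter]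
  split_ifs with h
  · rfl
  · simp

theorem subtypeCongr_apply_of_pos {n : ℕ} {p p' : Fin n → Prop} [DecidablePred p]
    [DecidablePred p'] (e : {x // p x} ≃ {x // p' x}) (f : {x // ¬ p x} ≃ {x // ¬ p' x})
    (x : {x // p x}) : Equiv.subtypeCongr e f x = e x := by
  simp [Equiv.subtypeCongr, Equiv.sumCompl_symm_apply_of_pos x.2]

theorem subtypeCongr_apply_of_neg {n : ℕ} {p p' : Fin n → Prop} [DecidablePred p]
    [DecidablePred p'] (e : {x // p x} ≃ {x // p' x}) (f : {x // ¬ p x} ≃ {x // ¬ p' x})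
    (x : {x // ¬ p x}) : Equiv.subtypeCongr e f x = f x := by
  simp [Equiv.subtypeCongr, Equiv.sumCompl_symm_apply_of_neg x.2]

theorem mem_excSet {n : ℕ} (σ : Equiv.Perm (Fin n)) (i : Fin n) : i ∈ excSet σ ↔ i < σ i := by
  simp [excSet, pos1, val1]

theorem den_subtypeCongr {n : ℕ} {E : Finset (Fin n)} {p p' : Fin n → Prop}
    [DecidablePred p] [DecidablePred p'] (hp : ∀ x, x ∈ E ↔ p x)
    (e : {x // p x} ≃ {x // p' x}) (f : {x // ¬ p x} ≃ {x // ¬ p' x})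
    (h : excSet (Equiv.subtypeCongr e f) = E) :
    den (Equiv.subtypeCongr e f) = ∑ x ∈ E, ((x : ℕ) + 1) + equivInv e + equivInv f := by
  have hmem : ∀ i, pos1 i < val1 (Equiv.subtypeCongr e f) i ↔ p i := by
    intro i
    rw [← hp, ← h]
    simp [excSet]
  rw [den, invOn_eq_equivInv _ _ _ _ hmem e (subtypeCongr_apply_of_pos e f),
    invOn_eq_equivInv _ _ _ _ (fun i => not_congr (hmem i)) f (subtypeCongr_apply_of_neg e f)]
  congr 2
  exact sum_congr h fun _ _ => rfl

theorem excSet_subtypeCongr_eq_iff {n : ℕ} {E : Finset (Fin n)} {p p' : Fin n → Prop}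
    [DecidablePred p] [DecidablePred p'] (hp : ∀ x, x ∈ E ↔ p x)
    (e : {x // p x} ≃ {x // p' x}) (f : {x // ¬ p x} ≃ {x // ¬ p' x}) :
    excSet (Equiv.subtypeCongr e f) = E ↔
      (∀ a : {x // p x}, (a : Fin n) < e a) ∧ ∀ a : {x // ¬ p x}, (f a : Fin n) ≤ a := by
  simp only [Finset.ext_iff, mem_excSet, hp]
  constructor
  · intro h
    refine ⟨fun a => ?_, fun a => ?_⟩
    · rw [← subtypeCongr_apply_of_pos e f, h]
      exact a.2
    · rw [← subtypeCongr_apply_of_neg e f, ← not_lt, h]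
      exact a.2
  · rintro ⟨h1, h2⟩ x
    by_cases hx : p x
    · have := h1 ⟨x, hx⟩
      rw [← subtypeCongr_apply_of_pos e f] at this
      exact iff_of_true this hx
    · have := h2 ⟨x, hx⟩
      rw [← subtypeCongr_apply_of_neg e f, ← not_lt] at this
      exact iff_of_false this hx

theorem sum_pow_den_of_letters {R : Type*} [CommRing R] (q : R) {n : ℕ}
    {E V : Finset (Fin n)} {p p' : Fin n → Prop} [DecidablePred p] [DecidablePred p']
    (hp : ∀ x, x ∈ E ↔ p x) (hp' : ∀ x, x ∈ V ↔ p' x) (hV : V.card = E.card) :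
    ∑ τ : Equiv.Perm (Fin n),
        (if (E.map τ.toEmbedding = V) ∧ excSet τ = E then q ^ den τ else 0) =
      q ^ (∑ x ∈ E, ((x : ℕ) + 1)) * ∏ s ∈ range n,
        qNat q (cntLT (E.map Fin.valEmbedding) s + 1 -
          cntLT (V.map Fin.valEmbedding) (s + 1)) := by
  have hpc : Fintype.card {x // p x} = Fintype.card {x // p' x} := by
    rw [Fintype.card_of_subtype E hp, Fintype.card_of_subtype V hp', hV]
  have hVc : Fintype.card {x // ¬ p x} = Fintype.card {x // ¬ p' x} := by
    rw [Fintype.card_subtype_compl, Fintype.card_subtype_compl, hpc]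
  have h1 := sum_pow_equivInv q (α := {x // p x}) (β := {x // p' x})
    (fun a b => (a : Fin n) < b)
    (fun a a' b b' ha hb h => lt_of_le_of_lt ha (lt_of_lt_of_le h hb)) hpc
  have h2 := sum_pow_equivInv_dual q (α := {x // ¬ p x}) (β := {x // ¬ p' x})
    (fun a b => (b : Fin n) ≤ a)
    (fun a a' b b' ha hb h => le_trans hb (le_trans h ha)) hVc
  have h3 : ∀ a : {x // p x},
      (univ.filter fun b : {x // p' x} => (a : Fin n) < b).card -
        (univ.filter fun x : {x // p x} => a < x).card =
      cntLT (E.map Fin.valEmbedding) (a : Fin n) + 1 -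
        cntLT (V.map Fin.valEmbedding) ((a : Fin n) + 1) := by
    intro a
    have e1 := card_gt_add_cntLT V a
    have e2 := card_gt_add_cntLT E a
    have e3 : cntLT (E.map Fin.valEmbedding) ((a : Fin n) + 1) =
        cntLT (E.map Fin.valEmbedding) (a : Fin n) + 1 :=
      cntLT_succ_of_mem (mem_map_of_mem Fin.valEmbedding ((hp _).2 a.2))
    have e4 := card_filter_subtype p' (fun x => (a : Fin n) < x)
    have e5 := card_filter_subtype p (fun x => (a : Fin n) < x)
    simp only [Subtype.coe_lt_coe] at e5
    simp only [hp, hp'] at e1 e2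
    omega
  have h4 : ∀ a : {x // ¬ p x},
      (univ.filter fun b : {x // ¬ p' x} => (b : Fin n) ≤ a).card -
        (univ.filter fun x : {x // ¬ p x} => x < a).card =
      cntLT (E.map Fin.valEmbedding) (a : Fin n) + 1 -
        cntLT (V.map Fin.valEmbedding) ((a : Fin n) + 1) := by
    intro a
    have e1 := card_mem_add_card_notMem V (t := (a : Fin n) + 1) (by omega)
    have e2 := card_mem_add_card_notMem E (t := (a : Fin n)) (by omega)
    rw [← cntLT_map] at e1 e2
    have e4 := card_filter_subtype (fun x => ¬ p' x) (fun x => (x : ℕ) < (a : Fin n) + 1)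
    have e5 := card_filter_subtype (fun x => ¬ p x) (fun x => (x : ℕ) < (a : Fin n))
    simp only [Nat.lt_succ_iff, Fin.val_fin_le, hp'] at e1 e4
    simp only [Fin.val_fin_lt, Subtype.coe_lt_coe, hp] at e2 e5
    omega
  rw [prod_congr rfl fun a _ => by rw [h3 a]] at h1
  rw [prod_congr rfl fun a _ => by rw [h4 a]] at h2
  rw [prod_range, ← Fintype.prod_subtype_mul_prod_subtype p, ← h1, ← h2,
    Fintype.sum_mul_sum, ← Fintype.sum_prod_type', mul_sum]
  symm
  refine Fintype.sum_of_injective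
    (fun g : ({x // p x} ≃ {x // p' x}) × ({x // ¬ p x} ≃ {x // ¬ p' x}) =>
      Equiv.subtypeCongr g.1 g.2) ?_ _ _ ?_ ?_
  · rintro ⟨e, f⟩ ⟨e', f'⟩ h
    have h' : ∀ x, Equiv.subtypeCongr e f x = Equiv.subtypeCongr e' f' x :=
      fun x => congrArg (fun g : Equiv.Perm (Fin n) => g x) h
    refine Prod.ext (Equiv.ext fun x => Subtype.ext ?_) (Equiv.ext fun x => Subtype.ext ?_)
    · simpa only [subtypeCongr_apply_of_pos] using h' x
    · simpa only [subtypeCongr_apply_of_neg] using h' x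
  · intro τ hτ
    refine if_neg fun h => hτ ?_
    have hmem : ∀ x, p x ↔ p' (τ x) := by
      intro x
      rw [← hp, ← hp', ← h.1]
      simp
    refine ⟨(τ.subtypeEquiv hmem, τ.subtypeEquiv fun x => not_congr (hmem x)),
      Equiv.ext fun x => ?_⟩
    by_cases hx : p x
    · exact subtypeCongr_apply_of_pos _ _ ⟨x, hx⟩
    · exact subtypeCongr_apply_of_neg _ _ ⟨x, hx⟩
  · rintro ⟨e, f⟩
    have hmap : E.map (Equiv.subtypeCongr e f).toEmbedding = V := by
      refine eq_of_subset_of_card_le ?_ (by simp [hV])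
      intro y hy
      obtain ⟨x, hx, rfl⟩ := mem_map.1 hy
      have := subtypeCongr_apply_of_pos e f ⟨x, (hp x).1 hx⟩
      simp only [Equiv.coe_toEmbedding] at this ⊢
      rw [this, hp']
      exact (e ⟨x, (hp x).1 hx⟩).2
    simp only [hmap, true_and]
    by_cases hE : excSet (Equiv.subtypeCongr e f) = E
    · have h5 := (excSet_subtypeCongr_eq_iff hp e f).1 hE
      rw [if_pos h5.1, if_pos h5.2, if_pos hE, den_subtypeCongr hp e f hE, pow_add, pow_add,
        mul_assoc]
    · rw [if_neg hE]
      by_cases h6 : ∀ a : {x // p x}, (a : Fin n) < e a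
      · rw [if_neg (fun h7 => hE ((excSet_subtypeCongr_eq_iff hp e f).2 ⟨h6, h7⟩)), mul_zero,
          mul_zero]
      · rw [if_neg h6, zero_mul, mul_zero]

theorem sum_pow_den {R : Type*} [CommRing R] (q : R) {n : ℕ} (E : Finset (Fin n)) :
    ∑ τ : Equiv.Perm (Fin n), (if excSet τ = E then q ^ den τ else 0) =
      q ^ (∑ x ∈ E, ((x : ℕ) + 1)) *
        letterSum q (E.map Fin.valEmbedding) n E.card := by
  have hrange : range n = (univ : Finset (Fin n)).map Fin.valEmbedding := by
    ext x
    simp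
  rw [letterSum]
  nth_rw 1 [hrange]
  rw [powersetCard_map, sum_map, mul_sum]
  simp only [RelEmbedding.coe_toEmbedding, mapEmbedding_apply]
  rw [sum_congr rfl fun V hV => (sum_pow_den_of_letters q (fun _ => Iff.rfl)
    (fun _ => Iff.rfl) (mem_powersetCard.1 hV).2).symm, sum_comm]
  refine sum_congr rfl fun τ _ => ?_
  rw [sum_eq_single (E.map τ.toEmbedding)]
  · simp
  · intro V _ hV
    exact if_neg fun h => hV h.1.symm
  · intro h
    simp at h

/-- The number of elements smaller than `k` outside `S`. -/
def coRank {m : ℕ} (S : Finset (Fin m)) (k : Fin m) : ℕ :=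
  ((univ \ S).filter fun j => j < k).card

theorem coRank_lt_coRank {m : ℕ} {S : Finset (Fin m)} {k l : Fin m} (hk : k ∉ S) (h : k < l) :
    coRank S k < coRank S l := by
  refine card_lt_card ((ssubset_iff_of_subset ?_).2 ⟨k, by simp [hk, h], by simp⟩)
  intro x hx
  simp only [mem_filter] at hx ⊢
  exact ⟨hx.1, hx.2.trans h⟩

theorem coRank_injOn {m : ℕ} {S : Finset (Fin m)} {k l : Fin m} (hk : k ∉ S) (hl : l ∉ S)
    (h : coRank S k = coRank S l) : k = l := by
  rcases lt_trichotomy k l with hkl | hkl | hkl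
  · exact absurd h (coRank_lt_coRank hk hkl).ne
  · exact hkl
  · exact absurd h (coRank_lt_coRank hl hkl).ne'

/-- The set `S` together with the `(c - |S|)`-th smallest element outside `S` if `c > |S|`. -/
def augment {m : ℕ} (S : Finset (Fin m)) (c : ℕ) : Finset (Fin m) :=
  S ∪ univ.filter fun k => k ∉ S ∧ S.card + 1 + coRank S k = c

theorem augment_of_le {m : ℕ} (S : Finset (Fin m)) {c : ℕ} (h : c ≤ S.card) :
    augment S c = S := by
  rw [augment, filter_false_of_mem (fun k _ hk => by omega), union_empty]

theorem augment_coRank {m : ℕ} {S : Finset (Fin m)} {k : Fin m} (hk : k ∉ S) :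
    augment S (S.card + 1 + coRank S k) = insert k S := by
  ext x
  simp only [augment, mem_union, mem_filter, mem_univ, true_and, mem_insert]
  constructor
  · rintro (h | ⟨h1, h2⟩)
    · exact Or.inr h
    · exact Or.inl (coRank_injOn h1 hk (by omega))
  · rintro (rfl | h)
    · exact Or.inr ⟨hk, rfl⟩
    · exact Or.inl h

theorem sum_range_succ_eq_add_sum_coRank {R : Type*} [AddCommMonoid R] {m : ℕ}
    (S : Finset (Fin m)) (G : ℕ → R) :
    ∑ c ∈ range (m + 1), G c =
      ∑ c ∈ range (S.card + 1), G c + ∑ k ∈ univ \ S, G (S.card + 1 + coRank S k) := by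
  have h : m + 1 = S.card + 1 + (univ \ S).card := by
    have h1 := card_sdiff_add_card_eq_card (subset_univ S)
    rw [card_univ, Fintype.card_fin] at h1
    omega
  rw [h, sum_range_add]
  congr 1
  exact (sum_comp_card_lt (univ \ S) fun i => G (S.card + 1 + i)).symm

theorem exists_coRank_eq {m : ℕ} (S : Finset (Fin m)) {c : ℕ} (h1 : S.card < c)
    (h2 : c < m + 1) : ∃ k, k ∉ S ∧ S.card + 1 + coRank S k = c := by
  by_contra! hne
  have h := sum_range_succ_eq_add_sum_coRank S fun i => if i = c then 1 else 0
  rw [sum_ite_eq' (range (m + 1)), sum_ite_eq' (range (S.card + 1)), if_pos (by simpa using h2),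
    if_neg (by simp; omega), sum_eq_zero] at h
  · exact absurd h (by simp)
  · intro k hk
    exact if_neg (hne k (by simpa using hk))

theorem card_add_coRank {m : ℕ} {S : Finset (Fin m)} {k : Fin m} (hk : k ∉ S) :
    S.card + 1 + coRank S k =
      (k : ℕ) + 1 + ((insert k S).filter fun x => k < x).card := by
  have h1 := card_gt_add_cntLT S k
  rw [cntLT_map] at h1
  have h2 := card_mem_add_card_notMem S (t := (k : ℕ) + 1) (by omega)
  have h3 : coRank S k + 1 = (univ.filter fun x => x ∉ S ∧ (x : ℕ) < k + 1).card := by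
    have : (univ.filter fun x => x ∉ S ∧ (x : ℕ) < k + 1) =
        insert k ((univ \ S).filter fun j => j < k) := by
      ext x
      simp only [mem_filter, mem_univ, true_and, mem_insert, mem_sdiff, Fin.ext_iff, Fin.lt_def]
      grind
    rw [this, card_insert_of_notMem (by simp), coRank]
  have h4 : ((insert k S).filter fun x => k < x) = univ.filter fun x => x ∈ S ∧ k < x := by
    ext x
    simp only [mem_filter, mem_univ, true_and, mem_insert]
    grind
  rw [h4]
  omega

theorem sum_augment {R : Type*} [CommRing R] (q : R) {m : ℕ} (S E : Finset (Fin m)) :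
    ∑ c ∈ range (m + 1), (if augment S c = E then q ^ c else 0) =
      (if S = E then qNat q (E.card + 1) else 0) +
        ∑ k ∈ E, if S = E.erase k then
          q ^ ((k : ℕ) + 1 + (E.filter fun x => k < x).card) else 0 := by
  rw [sum_range_succ_eq_add_sum_coRank S]
  congr 1
  · by_cases h : S = E
    · rw [if_pos h, ← h, qNat]
      refine sum_congr rfl fun c hc => if_pos (augment_of_le S ?_)
      simpa [Nat.lt_succ_iff] using hc
    · rw [if_neg h]
      refine sum_eq_zero fun c hc => if_neg ?_
      rwa [augment_of_le S (by simpa [Nat.lt_succ_iff] using hc)]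
  · have h1 : univ \ S = univ.filter fun k => k ∉ S := by
      ext x
      simp
    have h2 : E = univ.filter fun k => k ∈ E := by simp
    rw [h1, sum_filter]
    conv_rhs => rw [h2, sum_filter]
    refine sum_congr rfl fun k _ => ?_
    simp only [filter_univ_mem]
    by_cases hk : k ∈ S
    · rw [if_neg (not_not.2 hk)]
      split_ifs with h3 h4
      · rw [h4] at hk
        simp at hk
      · rfl
      · rfl
    · rw [if_pos hk, augment_coRank hk, card_add_coRank hk]
      by_cases h5 : insert k S = E
      · have h6 : S = E.erase k := by rw [← h5, erase_insert hk]
        rw [if_pos h5, if_pos (h5 ▸ mem_insert_self k S), if_pos h6, h5]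
      · rw [if_neg h5]
        split_ifs with h7 h8
        · exact absurd (by rw [h8, insert_erase h7]) h5
        · rfl
        · rfl

theorem sum_pow_den_add {R : Type*} [CommRing R] (q : R) {m : ℕ} (E : Finset (Fin m)) :
    ∑ σ : Equiv.Perm (Fin m), ∑ c : Fin (m + 1),
        (if augment (excSet σ) c = E then q ^ (den σ + c) else 0) =
      ∑ τ : Equiv.Perm (Fin (m + 1)),
        if excSet τ = E.map Fin.castSuccEmb then q ^ den τ else 0 := by
  have hval : (E.map Fin.castSuccEmb).map Fin.valEmbedding = E.map Fin.valEmbedding := by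
    rw [map_map]
    rfl
  have herase : ∀ k, (E.erase k).map Fin.valEmbedding = (E.map Fin.valEmbedding).erase k :=
    fun k => map_erase Fin.valEmbedding E k
  have hcnt : cntLT (E.map Fin.valEmbedding) m = E.card := by
    rw [cntLT_eq_card, card_map]
    intro x
    simp only [mem_map, mem_range]
    rintro ⟨y, -, rfl⟩
    exact y.2
  have hlhs : ∀ σ : Equiv.Perm (Fin m), ∑ c : Fin (m + 1),
      (if augment (excSet σ) c = E then q ^ (den σ + c) else 0) =
      qNat q (E.card + 1) * (if excSet σ = E then q ^ den σ else 0) +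
        ∑ k ∈ E, q ^ ((k : ℕ) + 1 + (E.filter fun x => k < x).card) *
          (if excSet σ = E.erase k then q ^ den σ else 0) := by
    intro σ
    have h := congrArg (fun x => q ^ den σ * x) (sum_augment q (excSet σ) E)
    simp only [mul_add, mul_sum, mul_ite, mul_zero, ← pow_add] at h
    rw [sum_range fun c => if augment (excSet σ) c = E then q ^ (den σ + c) else 0] at h
    rw [h]
    congr 1
    · rw [mul_ite, mul_zero, mul_comm]
    · refine sum_congr rfl fun k _ => ?_
      rw [mul_ite, mul_zero, ← pow_add, add_comm (den σ)]
  rw [sum_congr rfl fun σ _ => hlhs σ, sum_add_distrib, ← mul_sum, sum_comm, sum_pow_den,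
    sum_pow_den, hval, card_map, sum_map]
  simp only [← mul_sum, sum_pow_den, herase]
  simp only [Fin.val_castSucc, Fin.castSuccEmb_apply]
  have hterm : ∀ k ∈ E, q ^ ((k : ℕ) + 1 + (E.filter fun x => k < x).card) *
      (q ^ (∑ x ∈ E.erase k, ((x : ℕ) + 1)) *
        letterSum q ((E.map Fin.valEmbedding).erase k) m (E.erase k).card) =
      q ^ (∑ x ∈ E, ((x : ℕ) + 1)) * (q ^ (E.filter fun x => k < x).card *
        letterSum q ((E.map Fin.valEmbedding).erase k) m (E.card - 1)) := by
    intro k hk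
    rw [card_erase_of_mem hk, ← add_sum_erase E _ hk]
    ring
  rw [sum_congr rfl hterm, ← mul_sum, mul_left_comm, ← mul_add]
  congr 1
  rcases Nat.eq_zero_or_eq_succ_pred E.card with h0 | h0
  · rw [card_eq_zero.1 h0]
    simp only [sum_empty, add_zero, card_empty]
    rw [letterSum_succ_zero]
    simp [cntLT]
  · obtain ⟨j, hj⟩ : ∃ j, E.card = j + 1 := ⟨_, h0⟩
    rw [hj, letterSum_succ_eq, hcnt, hj, Nat.add_sub_cancel]
    congr 1
    rw [eraseSum, filter_map, sum_map, filter_true_of_mem (fun x _ => x.2)]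
    refine sum_congr rfl fun k _ => ?_
    rw [filter_map, card_map]
    congr 3
    ext x
    simp

theorem card_fiber_eq {m : ℕ} (F : Finset (Fin (m + 1))) (d : ℕ) :
    Fintype.card {p : Equiv.Perm (Fin m) × Fin (m + 1) //
        ((augment (excSet p.1) p.2).map Fin.castSuccEmb, den p.1 + p.2) = (F, d)} =
      Fintype.card {τ : Equiv.Perm (Fin (m + 1)) // (excSet τ, den τ) = (F, d)} := by
  by_cases hF : Fin.last m ∈ F
  · rw [Fintype.card_eq_zero_iff.2, Fintype.card_eq_zero_iff.2]
    · refine ⟨fun ⟨τ, hτ⟩ => ?_⟩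
      rw [Prod.mk.injEq] at hτ
      rw [← hτ.1, mem_excSet] at hF
      exact absurd (Fin.le_last (τ (Fin.last m))) hF.not_ge
    · refine ⟨fun ⟨p, hp⟩ => ?_⟩
      rw [Prod.mk.injEq] at hp
      rw [← hp.1, mem_map] at hF
      obtain ⟨x, -, hx⟩ := hF
      exact (Fin.castSucc_lt_last x).ne hx
  · obtain ⟨E, rfl⟩ : ∃ E : Finset (Fin m), F = E.map Fin.castSuccEmb := by
      refine ⟨univ.filter fun x => x.castSucc ∈ F, ?_⟩
      ext y
      induction y using Fin.lastCases with
      | last => simp [hF]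
      | cast y => simp
    have h := congrArg (fun f => Polynomial.coeff f d)
      (sum_pow_den_add (Polynomial.X : Polynomial ℤ) E)
    rw [← Fintype.sum_prod_type'] at h
    simp only [Polynomial.finsetSum_coeff, apply_ite (fun f => Polynomial.coeff f d),
      Polynomial.coeff_X_pow, Polynomial.coeff_zero, ← ite_and] at h
    rw [sum_boole, sum_boole, Nat.cast_inj] at h
    rw [Fintype.card_subtype, Fintype.card_subtype]
    simpa only [Prod.mk.injEq, map_inj, eq_comm (a := d)] using h

theorem exists_bijective_comp_eq {α β γ : Type*} [Fintype α] [Fintype β] [DecidableEq γ]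
    (f : α → γ) (g : β → γ)
    (h : ∀ y, Fintype.card {a // f a = y} = Fintype.card {b // g b = y}) :
    ∃ φ : α → β, Function.Bijective φ ∧ ∀ a, g (φ a) = f a := by
  let e : ∀ y, {a // f a = y} ≃ {b // g b = y} := fun y => Fintype.equivOfCardEq (h y)
  refine ⟨_, ((Equiv.sigmaFiberEquiv f).symm.trans
    ((Equiv.sigmaCongrRight e).trans (Equiv.sigmaFiberEquiv g))).bijective, fun a => ?_⟩
  exact (e (f a) ⟨a, rfl⟩).2

theorem exists_bijection_augment (m : ℕ) :
    ∃ φ : Equiv.Perm (Fin m) × Fin (m + 1) → Equiv.Perm (Fin (m + 1)),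
      Function.Bijective φ ∧ ∀ (σ : Equiv.Perm (Fin m)) (c : Fin (m + 1)),
        excSet (φ (σ, c)) = (augment (excSet σ) c).map Fin.castSuccEmb ∧
          den (φ (σ, c)) = den σ + c := by
  obtain ⟨φ, hφ, h⟩ := exists_bijective_comp_eq
    (fun p : Equiv.Perm (Fin m) × Fin (m + 1) =>
      ((augment (excSet p.1) p.2).map Fin.castSuccEmb, den p.1 + p.2))
    (fun τ : Equiv.Perm (Fin (m + 1)) => (excSet τ, den τ)) fun y => card_fiber_eq y.1 y.2
  exact ⟨φ, hφ, fun σ c => Prod.mk.inj (h (σ, c))⟩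

/-- Theorem 2.1: there is a bijection `φ : S_{n-1} × {0,…,n-1} → S_n` such that
`Exc(φ(σ,c)) = Exc(σ)` if `c ≤ exc(σ)`, `Exc(φ(σ,c)) = Exc(σ) ∪ {k_d}` otherwise
(where `k_d` is the `d`-th smallest non-excedance of `σ`, `d = c − exc(σ)`), and
`den(φ(σ,c)) = den(σ) + c`. -/
theorem exists_bijection_excSet_den (n : ℕ) (hn : 1 ≤ n) :
    ∃ φ : Equiv.Perm (Fin (n - 1)) × Fin n → Equiv.Perm (Fin n),
      Function.Bijective φ ∧
      ∀ (σ : Equiv.Perm (Fin (n - 1))) (c : Fin n),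
        (((c : ℕ) ≤ exc σ →
            excSet (φ (σ, c)) = (excSet σ).image (Fin.castLE (Nat.sub_le n 1))) ∧
         (exc σ < (c : ℕ) →
            ∃ k : Fin (n - 1), k ∉ excSet σ ∧
              (((univ \ excSet σ).filter fun j => j < k).card = (c : ℕ) - exc σ - 1) ∧
              excSet (φ (σ, c)) =
                insert (Fin.castLE (Nat.sub_le n 1) k)
                  ((excSet σ).image (Fin.castLE (Nat.sub_le n 1))))) ∧
        den (φ (σ, c)) = den σ + (c : ℕ) := by
  obtain ⟨m, rfl⟩ : ∃ m, n = m + 1 := ⟨n - 1, by omega⟩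
  obtain ⟨φ, hφ, h⟩ := exists_bijection_augment m
  refine ⟨φ, hφ, fun σ c => ⟨⟨fun hc => ?_, fun hc => ?_⟩, (h σ c).2⟩⟩
  · refine (h σ c).1.trans ?_
    rw [augment_of_le _ hc, map_eq_image]
    rfl
  · obtain ⟨k, hk, hkc⟩ := exists_coRank_eq (m := m) (excSet σ) hc c.2
    refine ⟨k, hk, ?_, (h σ c).1.trans ?_⟩
    · change coRank (m := m) (excSet σ) k = (c : ℕ) - (excSet σ).card - 1
      omega
    · rw [← hkc, augment_coRank hk, map_insert, map_eq_image]
      rfl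

end PaperStmt
end

section
/- Let g ≥ 1 and let n, h be integers with 1 ≤ h ≤ n. There exists a bijection φ from S_{n−1} × {0, 1, …, n−1} onto S_n such that for every σ ∈ S_{n−1} and every integer c with 0 ≤ c ≤ n−1: (i) if 0 ≤ c ≤ |gExclp_h(σ)| + g − 1 then gExclp_h(φ(σ,c)) = gExclp_h(σ), while otherwise gExclp_h(φ(σ,c)) = gExclp_h(σ) ∪ {k_d}, where d = c − |gExclp_h(σ)| − g + 1 and k_d is the d-th smallest element of [n−1] \ gExclp_h(σ); and (ii) g den_h(φ(σ,c)) = g den_h(σ) + c. (Theorem 4.1.) -/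
open Finset

namespace PaperStmt

section Transfer

variable {R : Type*} [CommSemiring R]

/-- The `q`-integer `1 + q + ⋯ + q^(n-1)`. -/
def qnum (q : R) (n : ℕ) : R := ∑ i ∈ range n, q ^ i

lemma qnum_one (q : R) : qnum q 1 = 1 := by simp [qnum]

lemma qnum_succ (q : R) (n : ℕ) : qnum q (n + 1) = qnum q n + q ^ n :=
  Finset.sum_range_succ _ _

lemma qnum_succ' (q : R) (n : ℕ) : qnum q (n + 1) = q * qnum q n + 1 := by
  simp [qnum, Finset.sum_range_succ', pow_succ', Finset.mul_sum]

lemma sum_pow_card_gt_s9 (q : R) (C : Finset ℕ) :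
    ∑ p ∈ C, q ^ #{j ∈ C | p < j} = qnum q #C := by
  induction C using Finset.induction_on_min with
  | empty => simp [qnum]
  | insert a s ha ih =>
    have hn : a ∉ s := fun h => lt_irrefl _ (ha a h)
    rw [sum_insert hn, card_insert_of_notMem hn, qnum_succ, ← ih, add_comm]
    congr 1
    · refine sum_congr rfl fun p hp => ?_
      rw [filter_insert, if_neg (ha p hp).not_gt]
    · rw [filter_insert, if_neg (lt_irrefl a), filter_true_of_mem ha]

lemma sum_pow_card_lt (q : R) (C : Finset ℕ) :
    ∑ p ∈ C, q ^ #{j ∈ C | j < p} = qnum q #C := by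
  induction C using Finset.induction_on_max with
  | empty => simp [qnum]
  | insert a s ha ih =>
    have hn : a ∉ s := fun h => lt_irrefl _ (ha a h)
    rw [sum_insert hn, card_insert_of_notMem hn, qnum_succ, ← ih, add_comm]
    congr 1
    · refine sum_congr rfl fun p hp => ?_
      rw [filter_insert, if_neg (ha p hp).not_gt]
    · rw [filter_insert, if_neg (lt_irrefl a), filter_true_of_mem ha]

/-- The least letter (counted from `0`) that makes position `k` (counted from `0`) a `g`-gap
`h`-level excedance-letter position. -/
def thr (g h k : ℕ) : ℕ := max (k + g) (h - 1)

/-- The weighted count of the placements of `v` letters at the positions in `S` for which the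
excedance-letter positions are those in `K`, by successive choice of the position of the
largest letter. -/
def placementSum (q : R) (g h : ℕ) (K : Finset ℕ) : ℕ → Finset ℕ → R
  | 0, _ => 1
  | v + 1, S => ∑ p ∈ S with (p ∈ K ↔ thr g h p ≤ v),
      q ^ #{j ∈ S | p < j ∧ (p ∈ K ↔ j ∈ K)} * placementSum q g h K v (S.erase p)

/-- The weighted count of placements of `v` letters, as a function of the set `A ⊆ K` of
excedance-letter positions they occupy. -/
def excSum (q : R) (g h : ℕ) (K : Finset ℕ) : ℕ → Finset ℕ → R
  | 0, A => if A = ∅ then 1 else 0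
  | v + 1, A =>
      qnum q (v + 1 - #A - #{p ∈ range (v + 1) | p ∉ K ∧ thr g h p ≤ v}) * excSum q g h K v A
      + ∑ k ∈ A with thr g h k ≤ v, q ^ #{j ∈ A | k < j} * excSum q g h K v (A.erase k)

lemma placementSum_eq_excSum (q : R) (g h : ℕ) (K : Finset ℕ) (v : ℕ) (S : Finset ℕ)
    (hS : #S = v) (hN : ∀ p, p ∉ K → thr g h p < v → p ∈ S) :
    placementSum q g h K v S = excSum q g h K v {p ∈ S | p ∈ K} := by
  induction v generalizing S with
  | zero =>
    rw [card_eq_zero] at hS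
    simp [placementSum, excSum, hS]
  | succ v ih =>
    rw [placementSum, excSum, sum_filter, ← sum_filter_add_sum_filter_not S (· ∈ K), add_comm]
    congr 1
    · have hC : #{p ∈ S | p ∉ K ∧ ¬ thr g h p ≤ v}
          = v + 1 - #{p ∈ S | p ∈ K} - #{p ∈ range (v + 1) | p ∉ K ∧ thr g h p ≤ v} := by
        have h1 := card_filter_add_card_filter_not (s := S) (fun p => p ∈ K)
        have h2 := card_filter_add_card_filter_not (s := {p ∈ S | p ∉ K})
          (fun p => thr g h p ≤ v)
        have h3 : {p ∈ range (v + 1) | p ∉ K ∧ thr g h p ≤ v}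
            = {p ∈ {p ∈ S | p ∉ K} | thr g h p ≤ v} := by
          ext p
          simp only [mem_filter, mem_range]
          constructor
          · rintro ⟨-, h4, h5⟩
            exact ⟨⟨hN p h4 (by omega), h4⟩, h5⟩
          · rintro ⟨⟨-, h4⟩, h5⟩
            refine ⟨?_, h4, h5⟩
            unfold thr at h5
            omega
        rw [h3]
        rw [filter_filter (fun p => p ∉ K) (fun p => ¬ thr g h p ≤ v)] at h2
        omega
      rw [← hC, ← sum_pow_card_gt_s9, sum_mul, ← sum_filter, filter_filter]
      refine sum_congr ?_ ?_
      · ext p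
        simp only [mem_filter]
        tauto
      · intro p hp
        simp only [mem_filter] at hp
        obtain ⟨hpS, hpK, hpt⟩ := hp
        rw [ih (S.erase p)]
        · congr 2
          · congr 1
            ext j
            simp only [mem_filter]
            constructor
            · rintro ⟨h1, h2, h3⟩
              refine ⟨⟨h1, by tauto, ?_⟩, h2⟩
              unfold thr at *
              omega
            · tauto
          · ext j
            simp only [mem_filter, mem_erase]
            constructor
            · tauto
            · rintro ⟨h1, h2⟩
              exact ⟨⟨fun h => hpK (h ▸ h2), h1⟩, h2⟩
        · rw [card_erase_of_mem hpS, hS]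
          rfl
        · intro j hj hjv
          exact mem_erase.2 ⟨by rintro rfl; omega, hN j hj (by omega)⟩
    · rw [← sum_filter, filter_filter, filter_filter]
      refine sum_congr ?_ ?_
      · ext p
        simp only [mem_filter]
        tauto
      · intro p hp
        simp only [mem_filter] at hp
        obtain ⟨hpS, hpK, hpt⟩ := hp
        rw [ih (S.erase p)]
        · congr 2
          · congr 1
            ext j
            simp only [mem_filter]
            tauto
          · ext j
            simp only [mem_filter, mem_erase]
            tauto
        · rw [card_erase_of_mem hpS, hS]
          rfl
        · intro j hj hjv
          exact mem_erase.2 ⟨by rintro rfl; exact hj hpK, hN j hj (by omega)⟩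

lemma excSum_eq_zero (q : R) (g h : ℕ) (K : Finset ℕ) (v : ℕ) (A : Finset ℕ) (m : ℕ)
    (hm : m ∈ A) (hv : v ≤ thr g h m) : excSum q g h K v A = 0 := by
  induction v generalizing A with
  | zero => simp [excSum, ne_empty_of_mem hm]
  | succ v ih =>
    rw [excSum, ih A hm (by omega), mul_zero, zero_add]
    refine sum_eq_zero fun k hk => ?_
    rw [mem_filter] at hk
    rw [ih (A.erase k) (mem_erase.2 ⟨by rintro rfl; omega, hm⟩) (by omega), mul_zero]

lemma excSum_erase (q : R) (g h : ℕ) (K : Finset ℕ) (v : ℕ) (A : Finset ℕ) (m : ℕ)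
    (hv : v ≤ thr g h m) : excSum q g h (K.erase m) v A = excSum q g h K v A := by
  induction v generalizing A with
  | zero => simp [excSum]
  | succ v ih =>
    rw [excSum, excSum, ih A (by omega)]
    congr 1
    · congr 4
      ext p
      simp only [mem_filter, mem_erase]
      constructor
      · rintro ⟨h1, h2, h3⟩
        exact ⟨h1, fun h4 => h2 ⟨by rintro rfl; omega, h4⟩, h3⟩
      · tauto
    · exact sum_congr rfl fun k _ => by rw [ih _ (by omega)]

/-- The number of pairs `o < a` with `o ∈ O` and `a ∈ A`. -/
def crossing (O A : Finset ℕ) : ℕ := ∑ o ∈ O, #{a ∈ A | o < a}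

/-- The weighted count of placements of `v` letters that leave exactly `H` of the
excedance-letter positions in `C` vacant. -/
def vacantSum (q : R) (g h : ℕ) (K C : Finset ℕ) (v H : ℕ) : R :=
  ∑ O ∈ C.powersetCard H, q ^ crossing O (C \ O) * excSum q g h K v (C \ O)

lemma vacantSum_zero (q : R) (g h : ℕ) (K C : Finset ℕ) (v : ℕ) :
    vacantSum q g h K C v 0 = excSum q g h K v C := by
  simp [vacantSum, crossing]

lemma vacantSum_erase (q : R) (g h : ℕ) (K C : Finset ℕ) (v H m : ℕ) (hv : v ≤ thr g h m) :
    vacantSum q g h (K.erase m) C v H = vacantSum q g h K C v H := by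
  simp only [vacantSum, excSum_erase q g h K v _ m hv]

lemma vacantSum_insert_zero (q : R) (g h : ℕ) (K C : Finset ℕ) (v m : ℕ)
    (hv : v ≤ thr g h m) : vacantSum q g h K (insert m C) v 0 = 0 := by
  rw [vacantSum_zero, excSum_eq_zero q g h K v _ m (mem_insert_self _ _) hv]

lemma vacantSum_insert_succ (q : R) (g h : ℕ) (K C : Finset ℕ) (v H m : ℕ)
    (hm : ∀ x ∈ C, x < m) (hv : v ≤ thr g h m) :
    vacantSum q g h K (insert m C) v (H + 1) = vacantSum q g h K C v H := by
  have hn : m ∉ C := fun h => lt_irrefl _ (hm m h)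
  have hdisj : Disjoint (powersetCard (H + 1) C) ((powersetCard H C).image (insert m)) := by
    rw [Finset.disjoint_left]
    intro O hO hO'
    obtain ⟨O', -, rfl⟩ := mem_image.1 hO'
    exact hn ((mem_powersetCard.1 hO).1 (mem_insert_self _ _))
  rw [vacantSum, powersetCard_succ_insert hn, sum_union hdisj, sum_image, sum_eq_zero, zero_add]
  · refine sum_congr rfl fun O hO => ?_
    have hOC := (mem_powersetCard.1 hO).1
    have hmO : m ∉ O := fun h => hn (hOC h)
    have hsd : insert m C \ insert m O = C \ O := by
      ext x
      simp only [mem_sdiff, mem_insert]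
      constructor
      · tauto
      · rintro ⟨h1, h2⟩
        exact ⟨Or.inr h1, by rintro (rfl | h3) <;> tauto⟩
    rw [hsd, crossing, sum_insert hmO, filter_false_of_mem, card_empty, zero_add, crossing]
    intro x hx
    exact (hm x (mem_sdiff.1 hx).1).not_gt
  · intro O hO
    rw [excSum_eq_zero q g h K v _ m _ hv, mul_zero]
    exact mem_sdiff.2 ⟨mem_insert_self _ _, fun h => hn ((mem_powersetCard.1 hO).1 h)⟩
  · intro O hO O' hO' he
    have h1 : m ∉ O := fun h => hn ((mem_powersetCard.1 hO).1 h)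
    have h2 : m ∉ O' := fun h => hn ((mem_powersetCard.1 hO').1 h)
    rw [← erase_insert h1, ← erase_insert h2]
    exact congrArg (fun s => s.erase m) he

lemma crossing_insert (O C : Finset ℕ) (k : ℕ) (hk : k ∈ C \ O) :
    crossing O (C \ O) + #{j ∈ C \ O | k < j}
      = crossing (insert k O) (C \ insert k O) + #{o ∈ insert k O | o < k} := by
  rw [mem_sdiff] at hk
  have hsd : C \ O = insert k (C \ insert k O) := by
    ext x
    simp only [mem_sdiff, mem_insert]
    by_cases hx : x = k
    · subst hx
      tauto
    · tauto
  have hkn : k ∉ C \ insert k O := by simp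
  rw [crossing, crossing, sum_insert hk.2, hsd, filter_insert, if_neg (lt_irrefl k),
    filter_insert, if_neg (lt_irrefl k), card_filter (fun o => o < k) O]
  have : ∑ o ∈ O, #{a ∈ insert k (C \ insert k O) | o < a}
      = ∑ o ∈ O, (#{a ∈ C \ insert k O | o < a} + if o < k then 1 else 0) := by
    refine sum_congr rfl fun o _ => ?_
    rw [filter_insert]
    split_ifs
    · rw [card_insert_of_notMem]
      simp
    · rfl
  rw [this, sum_add_distrib]
  ring

lemma vacantSum_succ (q : R) (g h : ℕ) (K C : Finset ℕ) (v H : ℕ) (hg : g ≤ v)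
    (hh : h ≤ v + 1) (hC : C = {k ∈ K | thr g h k ≤ v}) :
    vacantSum q g h K C (v + 1) H
      = qnum q (H + 1) * vacantSum q g h K C v (H + 1)
        + qnum q (H + g) * vacantSum q g h K C v H := by
  have hcount : #{p ∈ range (v + 1) | p ∉ K ∧ thr g h p ≤ v} + #C = v + 1 - g := by
    have h1 := card_filter_add_card_filter_not (s := range (v + 1 - g)) (fun p => p ∈ K)
    have h2 : C = {p ∈ range (v + 1 - g) | p ∈ K} := by
      ext p
      rw [hC, mem_filter, mem_filter, mem_range]
      unfold thr
      constructor
      · rintro ⟨h3, h4⟩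
        exact ⟨by omega, h3⟩
      · rintro ⟨h3, h4⟩
        exact ⟨h4, by omega⟩
    have h3 : {p ∈ range (v + 1) | p ∉ K ∧ thr g h p ≤ v}
        = {p ∈ range (v + 1 - g) | p ∉ K} := by
      ext p
      rw [mem_filter, mem_filter, mem_range, mem_range]
      unfold thr
      constructor
      · rintro ⟨h4, h5, h6⟩
        exact ⟨by omega, h5⟩
      · rintro ⟨h4, h5⟩
        exact ⟨by omega, h5, by omega⟩
    rw [card_range] at h1
    rw [h2, h3]
    omega
  have hstep : ∀ O ∈ C.powersetCard H, q ^ crossing O (C \ O) * excSum q g h K (v + 1) (C \ O)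
      = qnum q (H + g) * (q ^ crossing O (C \ O) * excSum q g h K v (C \ O))
        + ∑ k ∈ C \ O, q ^ #{o ∈ insert k O | o < k}
          * (q ^ crossing (insert k O) (C \ insert k O)
            * excSum q g h K v (C \ insert k O)) := by
    intro O hO
    obtain ⟨hOC, hOH⟩ := mem_powersetCard.1 hO
    have hM : v + 1 - #(C \ O) - #{p ∈ range (v + 1) | p ∉ K ∧ thr g h p ≤ v} = H + g := by
      have := card_sdiff_add_card_eq_card hOC
      omega
    rw [excSum, hM, mul_add, filter_true_of_mem, mul_sum]
    · congr 1
      · ring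
      · refine sum_congr rfl fun k hk => ?_
        have h1 := crossing_insert O C k hk
        have h2 : (C \ O).erase k = C \ insert k O := by
          ext x
          simp only [mem_erase, mem_sdiff, mem_insert]
          tauto
        rw [h2, ← mul_assoc, ← pow_add, h1, pow_add]
        ring
    · intro k hk
      rw [hC] at hk
      exact (mem_filter.1 (mem_sdiff.1 hk).1).2
  rw [vacantSum, sum_congr rfl hstep, sum_add_distrib, ← mul_sum, add_comm]
  congr 1
  rw [vacantSum, mul_sum]
  have hq : ∀ O' ∈ C.powersetCard (H + 1), qnum q (H + 1)
      * (q ^ crossing O' (C \ O') * excSum q g h K v (C \ O'))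
      = ∑ k ∈ O', q ^ #{o ∈ O' | o < k}
        * (q ^ crossing O' (C \ O') * excSum q g h K v (C \ O')) := by
    intro O' hO'
    rw [← (mem_powersetCard.1 hO').2, ← sum_pow_card_lt, sum_mul]
  rw [sum_congr rfl hq, sum_sigma', sum_sigma']
  refine sum_bij' (fun x _ => ⟨insert x.2 x.1, x.2⟩) (fun x _ => ⟨x.1.erase x.2, x.2⟩)
    ?_ ?_ ?_ ?_ ?_
  · rintro ⟨O, k⟩ hx
    simp only [mem_sigma, mem_powersetCard, mem_sdiff] at hx ⊢
    obtain ⟨⟨h1, h2⟩, h3, h4⟩ := hx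
    exact ⟨⟨insert_subset h3 h1, by rw [card_insert_of_notMem h4, h2]⟩, mem_insert_self _ _⟩
  · rintro ⟨O, k⟩ hx
    simp only [mem_sigma, mem_powersetCard, mem_sdiff] at hx ⊢
    obtain ⟨⟨h1, h2⟩, h3⟩ := hx
    exact ⟨⟨(erase_subset _ _).trans h1, by rw [card_erase_of_mem h3, h2]; rfl⟩, h1 h3,
      notMem_erase _ _⟩
  · rintro ⟨O, k⟩ hx
    simp only [mem_sigma, mem_sdiff] at hx
    simp [erase_insert hx.2.2]
  · rintro ⟨O, k⟩ hx
    simp only [mem_sigma] at hx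
    simp [insert_erase hx.2]
  · rintro ⟨O, k⟩ hx
    rfl

lemma vacantSum_transfer_insert (q : R) (g h v : ℕ) (K C : Finset ℕ) (m : ℕ)
    (hm : ∀ x ∈ C, x < m) (hv : v ≤ thr g h m)
    (hC : ∀ H, qnum q (H + 1) * vacantSum q g h K C v (H + 1)
        + qnum q (H + g) * vacantSum q g h K C v H
      = qnum q (#C + g) * vacantSum q g h K C v H
        + ∑ k ∈ C, q ^ #{j ∈ C | k < j} * vacantSum q g h (K.erase k) (C.erase k) v H) (H : ℕ) :
    qnum q (H + 1) * vacantSum q g h K (insert m C) v (H + 1)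
        + qnum q (H + g) * vacantSum q g h K (insert m C) v H
      = qnum q (#(insert m C) + g) * vacantSum q g h K (insert m C) v H
        + ∑ k ∈ insert m C, q ^ #{j ∈ insert m C | k < j}
          * vacantSum q g h (K.erase k) ((insert m C).erase k) v H := by
  have hn : m ∉ C := fun h => lt_irrefl _ (hm m h)
  have hlast : #{j ∈ insert m C | m < j} = 0 := by
    rw [card_eq_zero, filter_eq_empty_iff]
    intro x hx
    rcases mem_insert.1 hx with rfl | hx
    · exact lt_irrefl _
    · exact (hm x hx).not_gt
  have hne : ∀ k ∈ C, (insert m C).erase k = insert m (C.erase k) := fun k hk =>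
    erase_insert_of_ne (hm k hk).ne'
  have hm' : ∀ k, ∀ x ∈ C.erase k, x < m := fun k x hx => hm x (mem_of_mem_erase hx)
  rw [sum_insert hn, hlast, erase_insert hn, vacantSum_erase q g h K C v H m hv, pow_zero, one_mul,
    card_insert_of_notMem hn, vacantSum_insert_succ q g h K C v H m hm hv]
  cases H with
  | zero =>
    rw [vacantSum_insert_zero q g h K C v m hv, sum_eq_zero, zero_add, qnum_one]
    · ring
    · intro k hk
      rw [hne k hk, vacantSum_insert_zero q g h _ _ v m hv, mul_zero]
  | succ H =>
    rw [vacantSum_insert_succ q g h K C v H m hm hv]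
    have hsum : ∑ k ∈ C, q ^ #{j ∈ insert m C | k < j}
          * vacantSum q g h (K.erase k) ((insert m C).erase k) v (H + 1)
        = q * ∑ k ∈ C, q ^ #{j ∈ C | k < j} * vacantSum q g h (K.erase k) (C.erase k) v H := by
      rw [mul_sum]
      refine sum_congr rfl fun k hk => ?_
      rw [hne k hk, vacantSum_insert_succ q g h _ _ v H m (hm' k) hv, filter_insert,
        if_pos (hm k hk), card_insert_of_notMem (fun h => hn (mem_filter.1 h).1), pow_succ]
      ring
    rw [hsum, qnum_succ' q (H + 1), show H + 1 + g = H + g + 1 by ring,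
      show #C + 1 + g = #C + g + 1 by ring, qnum_succ' q (H + g), qnum_succ' q (#C + g)]
    calc _ = q * (qnum q (H + 1) * vacantSum q g h K C v (H + 1)
          + qnum q (H + g) * vacantSum q g h K C v H)
          + vacantSum q g h K C v (H + 1) + vacantSum q g h K C v H := by ring
      _ = _ := by rw [hC H]; ring

lemma vacantSum_transfer_empty (q : R) (g h v : ℕ) (K : Finset ℕ) (H : ℕ) :
    qnum q (H + 1) * vacantSum q g h K ∅ v (H + 1) + qnum q (H + g) * vacantSum q g h K ∅ v H
      = qnum q (#(∅ : Finset ℕ) + g) * vacantSum q g h K ∅ v H := by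
  have h0 : ∀ H, vacantSum q g h K ∅ v (H + 1) = 0 := fun H => by
    rw [vacantSum, powersetCard_eq_empty.2 (by simp), sum_empty]
  cases H <;> simp [h0]

lemma vacantSum_transfer (q : R) (g h v : ℕ) (hv : max g (h - 1) ≤ v) (K C : Finset ℕ)
    (hCK : C ⊆ K) (hKC : ∀ k ∈ K, thr g h k < v → k ∈ C) (H : ℕ) :
    qnum q (H + 1) * vacantSum q g h K C v (H + 1) + qnum q (H + g) * vacantSum q g h K C v H
      = qnum q (#C + g) * vacantSum q g h K C v H
        + ∑ k ∈ C, q ^ #{j ∈ C | k < j} * vacantSum q g h (K.erase k) (C.erase k) v H := by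
  induction v, hv using Nat.le_induction generalizing K C H with
  | base =>
    induction C using Finset.induction_on_max generalizing H with
    | empty => simpa using vacantSum_transfer_empty q g h _ K H
    | insert m C hm ih =>
      have hthr : ∀ k, max g (h - 1) ≤ thr g h k := fun k => by unfold thr; omega
      exact vacantSum_transfer_insert q g h _ K C m hm (hthr m)
        (ih ((subset_insert _ _).trans hCK) fun k _ hk => absurd hk (hthr k).not_gt) H
  | succ v hv ihv =>
    induction C using Finset.induction_on_max generalizing H with
    | empty => simpa using vacantSum_transfer_empty q g h _ K H
    | insert m C hm ih =>
      rcases le_or_gt (v + 1) (thr g h m) with hvm | hvm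
      · refine vacantSum_transfer_insert q g h _ K C m hm hvm
          (ih ((subset_insert _ _).trans hCK) fun k hk hkv => ?_) H
        refine mem_of_mem_insert_of_ne (hKC k hk hkv) ?_
        rintro rfl
        omega
      · have hC : insert m C = {k ∈ K | thr g h k ≤ v} := by
          ext k
          rw [mem_filter]
          constructor
          · intro hk
            refine ⟨hCK hk, ?_⟩
            rcases mem_insert.1 hk with rfl | hk
            · omega
            · have := hm k hk
              unfold thr at *
              omega
          · rintro ⟨h1, h2⟩
            exact hKC k h1 (by omega)
        clear ih
        generalize insert m C = C' at *
        have hT : ∀ k ∈ C', ∀ H, vacantSum q g h (K.erase k) (C'.erase k) (v + 1) H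
            = qnum q (H + 1) * vacantSum q g h (K.erase k) (C'.erase k) v (H + 1)
              + qnum q (H + g) * vacantSum q g h (K.erase k) (C'.erase k) v H := by
          intro k _ H
          refine vacantSum_succ q g h _ _ v H (by omega) (by omega) ?_
          rw [hC]
          ext x
          simp only [mem_filter, mem_erase]
          tauto
        have hsub : ∀ k ∈ K, thr g h k < v → k ∈ C' := fun k hk hkv => hKC k hk (by omega)
        rw [vacantSum_succ q g h K C' v H (by omega) (by omega) hC,
          vacantSum_succ q g h K C' v (H + 1) (by omega) (by omega) hC]
        have hsum : ∑ k ∈ C', q ^ #{j ∈ C' | k < j}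
              * vacantSum q g h (K.erase k) (C'.erase k) (v + 1) H
            = qnum q (H + 1) * ∑ k ∈ C', q ^ #{j ∈ C' | k < j}
              * vacantSum q g h (K.erase k) (C'.erase k) v (H + 1)
            + qnum q (H + g) * ∑ k ∈ C', q ^ #{j ∈ C' | k < j}
              * vacantSum q g h (K.erase k) (C'.erase k) v H := by
          rw [mul_sum, mul_sum, ← sum_add_distrib]
          refine sum_congr rfl fun k hk => ?_
          rw [hT k hk H]
          ring
        rw [hsum, ihv K C' hCK hsub (H + 1)]
        conv_lhs => rw [ihv K C' hCK hsub H]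
        ring

/-- The recursion obtained by deleting the largest letter and the last position. -/
lemma excSum_succ_self (q : R) (g h v : ℕ) (hh : h ≤ v + 1) (K : Finset ℕ)
    (hK : ∀ k ∈ K, thr g h k ≤ v) :
    excSum q g h K (v + 1) K = qnum q (min (#K + g) (v + 1)) * excSum q g h K v K
      + ∑ k ∈ K, q ^ #{j ∈ K | k < j} * excSum q g h (K.erase k) v (K.erase k) := by
  rcases le_or_gt g v with hg | hg
  · have hKc : #K ≤ v + 1 - g := by
      rw [← card_range (v + 1 - g)]
      refine card_le_card fun k hk => ?_
      have := hK k hk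
      unfold thr at this
      rw [mem_range]
      omega
    have hmin : min (#K + g) (v + 1) = #K + g := by omega
    have h1 := vacantSum_succ q g h K K v 0 hg hh (filter_true_of_mem hK).symm
    rw [vacantSum_transfer q g h v (by omega) K K subset_rfl (fun k hk _ => hk) 0] at h1
    simp only [vacantSum_zero] at h1
    rw [h1, hmin]
  · have hK0 : K = ∅ := by
      rw [eq_empty_iff_forall_notMem]
      intro k hk
      have := hK k hk
      unfold thr at this
      omega
    subst hK0
    have hN : #{p ∈ range (v + 1) | p ∉ (∅ : Finset ℕ) ∧ thr g h p ≤ v} = 0 := by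
      rw [card_eq_zero, filter_eq_empty_iff]
      rintro p - ⟨-, h1⟩
      unfold thr at h1
      omega
    have hmin : min (#(∅ : Finset ℕ) + g) (v + 1) = v + 1 := by
      rw [card_empty]
      omega
    rw [excSum, hN, hmin]
    simp

end Transfer

section Permutations

variable {R : Type*} [CommSemiring R]

/-- The permutation of `Fin (v + 1)` obtained from `σ` by inserting the largest letter at
position `p`. -/
def insertLast {v : ℕ} (p : Fin (v + 1)) (σ : Equiv.Perm (Fin v)) : Equiv.Perm (Fin (v + 1)) :=
  (finSuccEquiv' p).trans ((Equiv.optionCongr σ).trans (finSuccEquiv' (Fin.last v)).symm)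

lemma insertLast_self {v : ℕ} (p : Fin (v + 1)) (σ : Equiv.Perm (Fin v)) :
    insertLast p σ p = Fin.last v := by
  simp [insertLast]

lemma insertLast_succAbove {v : ℕ} (p : Fin (v + 1)) (σ : Equiv.Perm (Fin v)) (i : Fin v) :
    insertLast p σ (p.succAbove i) = (σ i).castSucc := by
  simp [insertLast]

lemma insertLast_bijective (v : ℕ) :
    Function.Bijective fun x : Fin (v + 1) × Equiv.Perm (Fin v) => insertLast x.1 x.2 := by
  rw [Fintype.bijective_iff_injective_and_card]
  refine ⟨?_, by simp [Fintype.card_perm, Nat.factorial_succ]⟩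
  rintro ⟨p, σ⟩ ⟨p', σ'⟩ he
  simp only at he
  have hp : p = p' := by
    apply (insertLast p' σ').injective
    rw [insertLast_self, ← he, insertLast_self]
  subst hp
  congr 1
  ext i
  have := congrArg (fun τ => ((τ (p.succAbove i) : Fin (v + 1)) : ℕ)) he
  simpa [insertLast_succAbove] using this

/-- The number of inversions of `σ` between positions on the same side of `P`. -/
def splitInv {n : ℕ} (σ : Equiv.Perm (Fin n)) (P : Fin n → Prop) [DecidablePred P] : ℕ :=
  ∑ i, ∑ j, if i < j ∧ (P i ↔ P j) ∧ σ j < σ i then 1 else 0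

lemma invOn_add_invOn_not {n : ℕ} (σ : Equiv.Perm (Fin n)) (P : Fin n → Prop)
    [DecidablePred P] : invOn σ P + invOn σ (fun i => ¬ P i) = splitInv σ P := by
  rw [invOn, invOn, card_filter, card_filter, Fintype.sum_prod_type, Fintype.sum_prod_type,
    ← sum_add_distrib, splitInv]
  simp only [← sum_add_distrib]
  refine sum_congr rfl fun i _ => sum_congr rfl fun j _ => ?_
  by_cases h1 : P i <;> by_cases h2 : P j <;> simp [h1, h2, val1]

lemma splitInv_insertLast {v : ℕ} (p : Fin (v + 1)) (σ : Equiv.Perm (Fin v))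
    (P : Fin (v + 1) → Prop) [DecidablePred P] :
    splitInv (insertLast p σ) P
      = #{j | p < j ∧ (P p ↔ P j)} + splitInv σ (fun i => P (p.succAbove i)) := by
  rw [splitInv, Fin.sum_univ_succAbove _ p]
  congr 1
  · rw [card_filter]
    refine sum_congr rfl fun j _ => ?_
    rw [insertLast_self]
    by_cases hj : p < j
    · have : insertLast p σ j < Fin.last v := by
        rw [lt_iff_le_and_ne]
        refine ⟨Fin.le_last _, fun h => hj.ne ?_⟩
        apply (insertLast p σ).injective
        rw [h, insertLast_self]
      simp [hj, this]
    · simp [hj]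
  · rw [splitInv]
    refine sum_congr rfl fun i _ => ?_
    rw [Fin.sum_univ_succAbove _ p, insertLast_self, if_neg, zero_add]
    · refine sum_congr rfl fun j _ => ?_
      simp [insertLast_succAbove]
    · rintro ⟨-, -, h⟩
      exact (Fin.le_last _).not_gt h

lemma sum_perm_eq_placementSum (q : R) (g h : ℕ) (K : Finset ℕ) (v : ℕ) (ι : Fin v → ℕ)
    (hι : StrictMono ι) :
    ∑ σ : Equiv.Perm (Fin v), (if ∀ i, (ι i ∈ K ↔ thr g h (ι i) ≤ σ i) then
        q ^ splitInv σ (fun i => ι i ∈ K) else 0)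
      = placementSum q g h K v (univ.image ι) := by
  induction v with
  | zero => simp [placementSum, splitInv]
  | succ v ih =>
    rw [← (insertLast_bijective v).sum_comp, Fintype.sum_prod_type, placementSum, sum_filter,
      sum_image hι.injective.injOn]
    refine sum_congr rfl fun p _ => ?_
    have himg : (univ.image ι).erase (ι p) = univ.image (fun i => ι (p.succAbove i)) := by
      ext x
      simp only [mem_erase, mem_image, mem_univ, true_and]
      constructor
      · rintro ⟨h1, i, rfl⟩
        obtain ⟨j, rfl⟩ := Fin.exists_succAbove_eq (y := p) (x := i) fun h => h1 (h ▸ rfl)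
        exact ⟨j, rfl⟩
      · rintro ⟨i, rfl⟩
        exact ⟨hι.injective.ne (Fin.succAbove_ne p i), _, rfl⟩
    have hcard : #{j ∈ univ.image ι | ι p < j ∧ (ι p ∈ K ↔ j ∈ K)}
        = #{j | p < j ∧ (ι p ∈ K ↔ ι j ∈ K)} := by
      rw [filter_image, card_image_of_injective _ hι.injective]
      simp only [hι.lt_iff_lt]
    rw [himg, hcard, ← ih (fun i => ι (p.succAbove i)) (hι.comp (Fin.strictMono_succAbove p)),
      mul_sum]
    split_ifs with hp
    · refine sum_congr rfl fun σ _ => ?_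
      have hiff : (∀ i, ι i ∈ K ↔ thr g h (ι i) ≤ (insertLast p σ i : ℕ))
          ↔ ∀ i, ι (p.succAbove i) ∈ K ↔ thr g h (ι (p.succAbove i)) ≤ (σ i : ℕ) := by
        rw [Fin.forall_iff_succAbove p]
        simp [insertLast_self, insertLast_succAbove, hp]
      simp only [hiff, splitInv_insertLast, pow_add]
      split_ifs <;> simp
    · refine sum_eq_zero fun σ _ => if_neg fun hall => hp ?_
      simpa [insertLast_self] using hall p

/-- The set of excedance-letter positions, counted from `0`. -/
def excPositions {n : ℕ} (g h : ℕ) (σ : Equiv.Perm (Fin n)) : Finset ℕ :=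
  (gExclpSet g h σ).image Fin.val

lemma mem_gExclpSet_iff {n g h : ℕ} (hh : 1 ≤ h) (σ : Equiv.Perm (Fin n)) (i : Fin n) :
    (pos1 i + g ≤ val1 σ i ∧ h ≤ val1 σ i) ↔ thr g h i ≤ σ i := by
  unfold pos1 val1 thr
  omega

lemma mem_excPositions {n g h : ℕ} (hh : 1 ≤ h) (σ : Equiv.Perm (Fin n)) (i : Fin n) :
    (i : ℕ) ∈ excPositions g h σ ↔ thr g h i ≤ σ i := by
  rw [← mem_gExclpSet_iff hh, excPositions, mem_image]
  simp [gExclpSet, Fin.val_inj]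

lemma card_excPositions {n : ℕ} (g h : ℕ) (σ : Equiv.Perm (Fin n)) :
    #(excPositions g h σ) = #(gExclpSet g h σ) :=
  card_image_of_injective _ Fin.val_injective

lemma lt_of_mem_excPositions {n g h k : ℕ} (hh : 1 ≤ h) (σ : Equiv.Perm (Fin n))
    (hk : k ∈ excPositions g h σ) : thr g h k < n := by
  obtain ⟨i, -, rfl⟩ := mem_image.1 hk
  exact ((mem_excPositions hh σ i).1 hk).trans_lt (σ i).isLt

lemma excPositions_eq_iff {n g h : ℕ} (hh : 1 ≤ h) (σ : Equiv.Perm (Fin n)) (K : Finset ℕ)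
    (hK : ∀ k ∈ K, k < n) :
    excPositions g h σ = K ↔ ∀ i : Fin n, (i : ℕ) ∈ K ↔ thr g h i ≤ σ i := by
  constructor
  · rintro rfl i
    exact mem_excPositions hh σ i
  · intro hall
    ext k
    constructor
    · intro hk
      obtain ⟨i, -, rfl⟩ := mem_image.1 hk
      exact (hall i).2 ((mem_excPositions hh σ i).1 hk)
    · intro hk
      exact (mem_excPositions hh σ ⟨k, hK k hk⟩).2 ((hall ⟨k, hK k hk⟩).1 hk)

lemma gden_eq {n g h : ℕ} (hg : 1 ≤ g) (σ : Equiv.Perm (Fin n)) :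
    gden g h σ = ∑ k ∈ excPositions g h σ, (k + g)
      + splitInv σ (fun i => (i : ℕ) ∈ excPositions g h σ) := by
  rw [gden, add_assoc, invOn_add_invOn_not, excPositions, sum_image Fin.val_injective.injOn]
  congr 1
  · refine sum_congr rfl fun i _ => ?_
    unfold pos1
    omega
  · simp [splitInv, gExclpSet, Fin.val_inj]

/-- The distribution of `gden` over the permutations with a given set of excedance-letter
positions. -/
lemma sum_perm_excPositions_eq (q : R) {n g h : ℕ} (hg : 1 ≤ g) (hh : 1 ≤ h) (K : Finset ℕ)
    (hK : ∀ k ∈ K, k < n) :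
    ∑ σ : Equiv.Perm (Fin n), (if excPositions g h σ = K then q ^ gden g h σ else 0)
      = q ^ (∑ k ∈ K, (k + g)) * excSum q g h K n K := by
  have himg : univ.image (fun i : Fin n => (i : ℕ)) = range n := by
    ext x
    simp only [mem_image, mem_univ, true_and, mem_range]
    exact ⟨by rintro ⟨i, rfl⟩; exact i.isLt, fun hx => ⟨⟨x, hx⟩, rfl⟩⟩
  have hfil : {p ∈ range n | p ∈ K} = K := by
    ext x
    simp only [mem_filter, mem_range]
    exact ⟨And.right, fun hx => ⟨hK x hx, hx⟩⟩
  have h1 := placementSum_eq_excSum q g h K n (range n) (card_range n) fun p _ hp => by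
    unfold thr at hp
    rw [mem_range]
    omega
  rw [hfil, ← himg, ← sum_perm_eq_placementSum q g h K n _ Fin.val_strictMono] at h1
  rw [← h1, mul_sum]
  refine sum_congr rfl fun σ _ => ?_
  simp only [← excPositions_eq_iff hh σ K hK]
  split_ifs with hE
  · rw [gden_eq hg, hE, pow_add]
  · rw [mul_zero]

end Permutations

section Insertion

variable {R : Type*} [CommSemiring R]

/-- The set of excedance-letter positions prescribed for the image of a permutation with
excedance-letter positions `K` and an integer `c`. -/
noncomputable def nextPositions (g : ℕ) (K : Finset ℕ) (c : ℕ) : Finset ℕ :=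
  if c < #K + g then K else insert (Nat.nth (· ∉ K) (c - #K - g)) K

lemma infinite_notMem (K : Finset ℕ) : {j | j ∉ K}.Infinite :=
  K.finite_toSet.infinite_compl

lemma nth_notMem (K : Finset ℕ) (d : ℕ) : Nat.nth (· ∉ K) d ∉ K :=
  Nat.nth_mem_of_infinite (infinite_notMem K) d

lemma card_filter_nth_notMem (K : Finset ℕ) (d : ℕ) :
    #{j ∈ range (Nat.nth (· ∉ K) d) | j ∉ K} = d := by
  rw [← Nat.count_eq_card_filter_range, Nat.count_nth_of_infinite (infinite_notMem K)]

lemma nth_card_filter_notMem (K : Finset ℕ) (k : ℕ) (hk : k ∉ K) :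
    Nat.nth (· ∉ K) #{j ∈ range k | j ∉ K} = k := by
  rw [← Nat.count_eq_card_filter_range, Nat.nth_count hk]

lemma nth_notMem_le (K : Finset ℕ) (d : ℕ) : Nat.nth (· ∉ K) d ≤ d + #K := by
  have h1 := card_filter_nth_notMem K d
  have h2 := card_filter_add_card_filter_not (s := range (Nat.nth (· ∉ K) d)) (fun j => j ∈ K)
  have h3 : #{j ∈ range (Nat.nth (· ∉ K) d) | j ∈ K} ≤ #K :=
    card_le_card fun j hj => (mem_filter.1 hj).2
  rw [card_range] at h2
  omega

/-- Positions below `k` outside `K` and elements of `K` below and above `k`. -/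
lemma card_add_card_filter_notMem (K : Finset ℕ) (k : ℕ) (hk : k ∉ K) :
    #K + #{j ∈ range k | j ∉ K} = k + #{j ∈ K | k < j} := by
  have h1 := card_filter_add_card_filter_not (s := range k) (fun j => j ∈ K)
  have h2 := card_filter_add_card_filter_not (s := K) (fun j => k < j)
  have h3 : {j ∈ K | ¬ k < j} = {j ∈ range k | j ∈ K} := by
    ext j
    simp only [mem_filter, mem_range]
    constructor
    · rintro ⟨h4, h5⟩
      have : j ≠ k := by rintro rfl; exact hk h4
      exact ⟨by omega, h4⟩
    · rintro ⟨h4, h5⟩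
      exact ⟨h5, by omega⟩
  rw [card_range] at h1
  rw [h3] at h2
  omega

lemma sum_nextPositions (q : R) (g n : ℕ) (K K' : Finset ℕ) (hK : ∀ k ∈ K, k + g < n) :
    ∑ c ∈ range n, (if nextPositions g K' c = K then q ^ c else 0)
      = (if K' = K then qnum q (min (#K + g) n) else 0)
        + ∑ k ∈ K, if K' = K.erase k then q ^ (k + g + #{j ∈ K | k < j}) else 0 := by
  rw [← sum_filter_add_sum_filter_not (range n) (fun c => c < #K' + g)]
  congr 1
  · have hr : {c ∈ range n | c < #K' + g} = range (min (#K' + g) n) := by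
      ext c
      simp only [mem_filter, mem_range]
      omega
    rw [hr]
    split_ifs with hKK
    · rw [qnum, ← hKK]
      refine sum_congr rfl fun c hc => if_pos ?_
      rw [mem_range] at hc
      rw [nextPositions, if_pos (by omega)]
    · refine sum_eq_zero fun c hc => if_neg ?_
      rw [mem_range] at hc
      rwa [nextPositions, if_pos (by omega)]
  · rw [← sum_filter, ← sum_filter]
    have hfil : ∀ k, {j ∈ K.erase k | k < j} = {j ∈ K | k < j} := by
      intro k
      ext j
      simp only [mem_filter, mem_erase]
      exact ⟨fun hj => ⟨hj.1.2, hj.2⟩, fun hj => ⟨⟨hj.2.ne', hj.1⟩, hj.2⟩⟩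
    have hfwd : ∀ c ∈ {c ∈ {c ∈ range n | ¬ c < #K' + g} | nextPositions g K' c = K},
        #K' + g ≤ c ∧ Nat.nth (· ∉ K') (c - #K' - g) ∈ K
          ∧ K' = K.erase (Nat.nth (· ∉ K') (c - #K' - g))
          ∧ Nat.nth (· ∉ K') (c - #K' - g) + g
            + #{j ∈ K | Nat.nth (· ∉ K') (c - #K' - g) < j} = c := by
      intro c hc
      simp only [mem_filter, mem_range] at hc
      obtain ⟨⟨-, hc1⟩, hc2⟩ := hc
      rw [nextPositions, if_neg hc1] at hc2
      have hn := nth_notMem K' (c - #K' - g)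
      have hcard := card_add_card_filter_notMem K' _ hn
      rw [card_filter_nth_notMem] at hcard
      have hE : K' = K.erase (Nat.nth (· ∉ K') (c - #K' - g)) := by
        rw [← hc2, erase_insert hn]
      refine ⟨by omega, hc2 ▸ mem_insert_self _ _, hE, ?_⟩
      rw [← hfil, ← hE]
      omega
    have hbwd : ∀ k ∈ {k ∈ K | K' = K.erase k}, k ∈ K ∧ k ∉ K' ∧ insert k K' = K
        ∧ #K' + g ≤ k + g + #{j ∈ K | k < j}
        ∧ k + g + #{j ∈ K | k < j} < n
        ∧ Nat.nth (· ∉ K') (k + g + #{j ∈ K | k < j} - #K' - g) = k := by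
      intro k hk
      obtain ⟨hkK, hE⟩ := mem_filter.1 hk
      have hn : k ∉ K' := hE ▸ notMem_erase k K
      have hcard := card_add_card_filter_notMem K' k hn
      have hbound : #{j ∈ K | k < j} ≤ n - g - (k + 1) := by
        rw [← Nat.card_Ico]
        refine card_le_card fun j hj => ?_
        obtain ⟨h1, h2⟩ := mem_filter.1 hj
        have := hK j h1
        rw [mem_Ico]
        omega
      have := hK k hkK
      rw [hE, hfil, ← hE] at hcard
      refine ⟨hkK, hn, by rw [hE, insert_erase hkK], by omega, by omega, ?_⟩
      rw [show k + g + #{j ∈ K | k < j} - #K' - g = #{j ∈ range k | j ∉ K'} by omega,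
        nth_card_filter_notMem K' k hn]
    refine sum_bij' (fun c _ => Nat.nth (· ∉ K') (c - #K' - g))
      (fun k _ => k + g + #{j ∈ K | k < j}) ?_ ?_ ?_ ?_ ?_
    · intro c hc
      obtain ⟨-, h1, h2, -⟩ := hfwd c hc
      exact mem_filter.2 ⟨h1, h2⟩
    · intro k hk
      obtain ⟨-, -, h1, h2, h3, h4⟩ := hbwd k hk
      simp only [mem_filter, mem_range]
      refine ⟨⟨h3, h2.not_gt⟩, ?_⟩
      rw [nextPositions, if_neg h2.not_gt, h4, h1]
    · intro c hc
      exact (hfwd c hc).2.2.2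
    · intro k hk
      exact (hbwd k hk).2.2.2.2.2
    · intro c hc
      rw [(hfwd c hc).2.2.2]

lemma lt_of_mem_nextPositions {g h n : ℕ} (hg : 1 ≤ g) (hhn : h ≤ n + 1) (K : Finset ℕ)
    (hK : ∀ k ∈ K, thr g h k < n) (c : ℕ) (hc : c < n + 1) :
    ∀ k ∈ nextPositions g K c, thr g h k < n + 1 := by
  intro k hk
  unfold nextPositions at hk
  split_ifs at hk with hcs
  · exact (hK k hk).trans (Nat.lt_succ_self n)
  · rcases mem_insert.1 hk with rfl | hk
    · have := nth_notMem_le K (c - #K - g)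
      unfold thr
      omega
    · exact (hK k hk).trans (Nat.lt_succ_self n)

/-- The joint distribution of the set of excedance-letter positions and `gden` over
permutations of `n + 1` letters, in terms of permutations of `n` letters. -/
lemma sum_perm_succ_eq (q : R) {g h n : ℕ} (hg : 1 ≤ g) (hh : 1 ≤ h) (hhn : h ≤ n + 1)
    (K : Finset ℕ) :
    ∑ τ : Equiv.Perm (Fin (n + 1)), (if excPositions g h τ = K then q ^ gden g h τ else 0)
      = ∑ x : Equiv.Perm (Fin n) × Fin (n + 1),
        if nextPositions g (excPositions g h x.1) x.2 = K then q ^ (gden g h x.1 + x.2)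
        else 0 := by
  by_cases hK : ∀ k ∈ K, thr g h k < n + 1
  · have hK1 : ∀ k ∈ K, k + g < n + 1 := fun k hk => by
      have := hK k hk
      unfold thr at this
      omega
    have hK2 : ∀ k ∈ K, k < n := fun k hk => by
      have := hK1 k hk
      omega
    have hinner : ∀ σ : Equiv.Perm (Fin n),
        ∑ c : Fin (n + 1), (if nextPositions g (excPositions g h σ) c = K then
            q ^ (gden g h σ + c) else 0)
          = qnum q (min (#K + g) (n + 1))
              * (if excPositions g h σ = K then q ^ gden g h σ else 0)
            + ∑ k ∈ K, q ^ (k + g + #{j ∈ K | k < j})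
              * (if excPositions g h σ = K.erase k then q ^ gden g h σ else 0) := by
      intro σ
      have h1 := sum_nextPositions q g (n + 1) K (excPositions g h σ) hK1
      rw [← Fin.sum_univ_eq_sum_range (fun c => if nextPositions g (excPositions g h σ) c = K
        then q ^ c else 0) (n + 1)] at h1
      calc _ = q ^ gden g h σ * ∑ c : Fin (n + 1),
            (if nextPositions g (excPositions g h σ) c = K then q ^ (c : ℕ) else 0) := by
            rw [mul_sum]
            refine sum_congr rfl fun c _ => ?_
            rw [mul_ite, mul_zero, pow_add]
        _ = _ := by
            rw [h1, mul_add, mul_sum]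
            congr 1
            · split_ifs <;> ring
            · refine sum_congr rfl fun k _ => ?_
              split_ifs <;> ring
    rw [Fintype.sum_prod_type, sum_congr rfl fun σ _ => hinner σ, sum_add_distrib, ← mul_sum,
      sum_comm, sum_perm_excPositions_eq q hg hh K hK2,
      sum_perm_excPositions_eq q hg hh K fun k hk => (hK2 k hk).trans (Nat.lt_succ_self n),
      excSum_succ_self q g h n hhn K fun k hk => Nat.lt_succ_iff.1 (hK k hk), mul_add]
    congr 1
    · ring
    · rw [mul_sum]
      refine sum_congr rfl fun k hk => ?_
      rw [← mul_sum, sum_perm_excPositions_eq q hg hh (K.erase k)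
        fun j hj => hK2 j (mem_of_mem_erase hj), ← add_sum_erase K _ hk]
      ring
  · rw [sum_eq_zero, sum_eq_zero]
    · rintro ⟨σ, c⟩ -
      refine if_neg ?_
      rintro rfl
      exact hK (lt_of_mem_nextPositions hg hhn _
        (fun k hk => lt_of_mem_excPositions hh σ hk) c c.isLt)
    · intro τ _
      refine if_neg ?_
      rintro rfl
      exact hK fun k hk => lt_of_mem_excPositions hh τ hk

lemma coeff_sum_ite_X_pow {α : Type*} [Fintype α] (p : α → Prop) [DecidablePred p]
    (f : α → ℕ) (m : ℕ) :
    (∑ a, if p a then (Polynomial.X : Polynomial ℕ) ^ f a else 0).coeff m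
      = #{a | p a ∧ f a = m} := by
  rw [Polynomial.finsetSum_coeff, card_filter]
  refine sum_congr rfl fun a _ => ?_
  by_cases hp : p a <;> simp [hp, Polynomial.coeff_X_pow, eq_comm]

lemma exists_equiv_nextPositions {g h n : ℕ} (hg : 1 ≤ g) (hh : 1 ≤ h) (hhn : h ≤ n + 1) :
    ∃ φ : Equiv.Perm (Fin n) × Fin (n + 1) ≃ Equiv.Perm (Fin (n + 1)),
      ∀ x, excPositions g h (φ x) = nextPositions g (excPositions g h x.1) x.2
        ∧ gden g h (φ x) = gden g h x.1 + x.2 := by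
  let F : Equiv.Perm (Fin n) × Fin (n + 1) → Finset ℕ × ℕ := fun x =>
    (nextPositions g (excPositions g h x.1) x.2, gden g h x.1 + x.2)
  let G : Equiv.Perm (Fin (n + 1)) → Finset ℕ × ℕ := fun τ => (excPositions g h τ, gden g h τ)
  have hcard : ∀ y, Nonempty ({x // F x = y} ≃ {τ // G τ = y}) := by
    rintro ⟨K, m⟩
    have h1 := congrArg (fun p => Polynomial.coeff p m)
      (sum_perm_succ_eq (Polynomial.X : Polynomial ℕ) hg hh hhn K)
    simp only [coeff_sum_ite_X_pow] at h1
    rw [← Fintype.card_eq, Fintype.card_subtype, Fintype.card_subtype]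
    simpa [F, G, Prod.ext_iff] using h1.symm
  let φ := Equiv.ofFiberEquiv fun y => (hcard y).some
  refine ⟨φ, fun x => ?_⟩
  have hφ : G (φ x) = F x := Equiv.ofFiberEquiv_map _ x
  exact Prod.ext_iff.1 hφ

end Insertion

/-- Theorem 4.1: for `g ≥ 1` and `1 ≤ h ≤ n`, there is a bijection
`φ : S_{n-1} × {0,…,n-1} → S_n` such that `gExclp_h(φ(σ,c)) = gExclp_h(σ)` if
`c ≤ |gExclp_h(σ)| + g − 1`, `gExclp_h(φ(σ,c)) = gExclp_h(σ) ∪ {k_d}` otherwise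
(where `k_d` is the `d`-th smallest non-`g`-gap-`h`-level excedance-letter position of `σ`,
`d = c − |gExclp_h(σ)| − g + 1`), and `g den_h(φ(σ,c)) = g den_h(σ) + c`. -/
theorem exists_bijection_gExclpSet_gden (g h n : ℕ) (hg : 1 ≤ g) (hh : 1 ≤ h)
    (hhn : h ≤ n) :
    ∃ φ : Equiv.Perm (Fin (n - 1)) × Fin n → Equiv.Perm (Fin n),
      Function.Bijective φ ∧
      ∀ (σ : Equiv.Perm (Fin (n - 1))) (c : Fin n),
        (((c : ℕ) ≤ (gExclpSet g h σ).card + g - 1 →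
            gExclpSet g h (φ (σ, c)) =
              (gExclpSet g h σ).image (Fin.castLE (Nat.sub_le n 1))) ∧
         ((gExclpSet g h σ).card + g - 1 < (c : ℕ) →
            ∃ k : Fin (n - 1), k ∉ gExclpSet g h σ ∧
              (((univ \ gExclpSet g h σ).filter fun j => j < k).card
                 = (c : ℕ) - (gExclpSet g h σ).card - g) ∧
              gExclpSet g h (φ (σ, c)) =
                insert (Fin.castLE (Nat.sub_le n 1) k)
                  ((gExclpSet g h σ).image (Fin.castLE (Nat.sub_le n 1))))) ∧
        gden g h (φ (σ, c)) = gden g h σ + (c : ℕ) := by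
  obtain ⟨m, rfl⟩ : ∃ m, n = m + 1 := ⟨n - 1, by omega⟩
  obtain ⟨φ, hφ⟩ := exists_equiv_nextPositions hg hh hhn
  refine ⟨φ, φ.bijective, fun σ c => ?_⟩
  change Equiv.Perm (Fin m) at σ
  obtain ⟨h1, h2⟩ := hφ (σ, c)
  have hcast : ∀ S : Finset (Fin m),
      (S.image (Fin.castLE (Nat.sub_le (m + 1) 1))).image Fin.val = S.image Fin.val := fun S => by
    rw [image_image]
    rfl
  rw [nextPositions, card_excPositions] at h1
  refine ⟨⟨fun hc => ?_, fun hc => ?_⟩, h2⟩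
  · apply image_injective Fin.val_injective
    rw [if_pos (by simp only; omega)] at h1
    exact h1.trans (hcast _).symm
  · rw [if_neg (by simp only; omega)] at h1
    simp only at h1
    set d := (c : ℕ) - #(gExclpSet g h σ) - g with hd
    have hk : Nat.nth (· ∉ excPositions g h σ) d < m := by
      have := nth_notMem_le (excPositions g h σ) d
      rw [card_excPositions] at this
      have := c.isLt
      omega
    have hn := nth_notMem (excPositions g h σ) d
    have hcard := card_filter_nth_notMem (excPositions g h σ) d
    have hmem : ∀ i : Fin m, (i : ℕ) ∈ excPositions g h σ ↔ i ∈ gExclpSet g h σ := fun i => by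
      simp [excPositions, Fin.val_inj]
    generalize Nat.nth (· ∉ excPositions g h σ) d = k at *
    refine ⟨⟨k, hk⟩, fun hk' => hn ((hmem _).2 hk'), ?_, ?_⟩
    · rw [← hcard, ← card_image_of_injective _ Fin.val_injective]
      congr 1
      ext j
      simp only [mem_image, mem_filter, mem_sdiff, mem_univ, true_and, mem_range]
      constructor
      · rintro ⟨i, ⟨h3, h4⟩, rfl⟩
        exact ⟨h4, fun h5 => h3 ((hmem i).1 h5)⟩
      · rintro ⟨h3, h4⟩
        exact ⟨⟨j, h3.trans hk⟩, ⟨fun h5 => h4 ((hmem _).2 h5), h3⟩, rfl⟩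
    · apply image_injective Fin.val_injective
      rw [image_insert]
      refine h1.trans ?_
      congr 1
      exact (hcast _).symm

end PaperStmt
end
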